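/- Assume additionally that the Fourier transform ĩk(λ) = ∫ ik(x)e^{iλx} dx satisfies ĩk(λ) = O(|λ|^{−3}) as λ → ∞. Let x₀ ∈ ℝ² be a point not on S such that no line through x₀ that intersects S is tangent to S (at the endpoints of S one-sided tangents are considered). Suppose the level sets of H₀ are well-behaved: there exist ρ, L₀ > 0, independent of t̂ and of ε, such that for every t̂ ∈ ℝ, every open interval of length L ≥ L₀ contains at most ρL points of H₀^{−1}(t̂). Then f_ε^rec(x) = O(ε^{1/2} ln(1/ε)) as ε → 0, uniformly with respect to x in a sufficiently small neighborhood of x₀. -/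

import Mathlib

open MeasureTheory Filter Topology

/-- Dot product on `ℝ²`. -/
noncomputable def dot2 (u v : ℝ × ℝ) : ℝ := u.1 * v.1 + u.2 * v.2

/-- The unit vector `Θ⃗ = (cos θ, sin θ)`. -/
noncomputable def vec (θ : ℝ) : ℝ × ℝ := (Real.cos θ, Real.sin θ)

/-- The signed indicator `χ_H` of the interval with endpoints `0` and `H`. -/
noncomputable def chiInd (H t : ℝ) : ℝ :=
  if 0 < H ∧ 0 ≤ t ∧ t ≤ H then 1
  else if H < 0 ∧ H ≤ t ∧ t ≤ 0 then -1 else 0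

/-- Convolution on `ℝ`. -/
noncomputable def conv1 (f g : ℝ → ℝ) (x : ℝ) : ℝ := ∫ y : ℝ, f y * g (x - y)

lemma setOf_lt_abs_measurable (δ p : ℝ) : MeasurableSet {s : ℝ | δ < |s - p|} :=
  measurableSet_lt measurable_const (by fun_prop)

lemma integrable_indicator_Icc_const (a b c : ℝ) :
    Integrable ((Set.Icc a b).indicator fun _ : ℝ => c) :=
  (integrable_indicator_iff measurableSet_Icc).2 (by simp)

/-- A truncated Hilbert transform of a Lipschitz function supported in `[q - Rε, q + Rε]`. -/
lemma abs_truncated_hilbert_le {φ : ℝ → ℝ} {M R ε q p δ : ℝ} (hM : 0 ≤ M) (hR : 0 ≤ R)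
    (hε : 0 < ε) (hδ : 0 < δ) (hφ : Continuous φ) (hb : ∀ s, |φ s| ≤ M / ε)
    (hL : ∀ s t, |φ s - φ t| ≤ M / ε ^ 2 * |s - t|)
    (hs : ∀ s, R * ε < |s - q| → φ s = 0) :
    |∫ s in {s : ℝ | δ < |s - p|}, φ s / (s - p)| ≤ 8 * M * R * (1 + R) / (ε + |p - q|) := by
  set d := |p - q| with hd
  have hd0 : 0 ≤ d := abs_nonneg _
  set r := R * ε with hr
  have hr0 : 0 ≤ r := by positivity
  set S : Set ℝ := {u : ℝ | δ < |u|} with hS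
  have hSm : MeasurableSet S := measurableSet_lt measurable_const (by fun_prop)
  set F : ℝ → ℝ := S.indicator (fun u => φ (p + u) / u) with hF
  set c := 4 * M * (1 + R) / (ε * (ε + d)) with hc
  have hc0 : 0 ≤ c := by positivity
  set B₁ := Set.Icc (d - r) (d + r)
  set B₂ := Set.Icc (-d - r) (-d + r)
  set g : ℝ → ℝ := fun u => B₁.indicator (fun _ => c) u + B₂.indicator (fun _ => c) u with hg
  have h1 : ∫ s in {s : ℝ | δ < |s - p|}, φ s / (s - p) = ∫ u, F u := by
    rw [← integral_indicator (setOf_lt_abs_measurable δ p), ← integral_add_left_eq_self _ p]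
    congr 1; ext u
    simp only [hF, Set.indicator, hS, Set.mem_ofPred_eq, add_sub_cancel_left]
  have hFint : Integrable F := by
    have hb' : ∀ u, ‖F u‖ ≤ (Set.Icc (q - p - r) (q - p + r)).indicator
        (fun _ => M / ε / δ) u := by
      intro u
      by_cases hu : u ∈ S
      · have hu' : δ < |u| := hu
        rw [hF, Set.indicator_of_mem hu]
        by_cases hm : u ∈ Set.Icc (q - p - r) (q - p + r)
        · rw [Set.indicator_of_mem hm, Real.norm_eq_abs, abs_div]
          exact div_le_div₀ (by positivity) (hb _) hδ hu'.le
        · rw [hs (p + u), zero_div, norm_zero]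
          · exact Set.indicator_nonneg (fun _ _ => by positivity) _
          · by_contra h
            push Not at h
            rw [abs_le] at h
            exact hm ⟨by linarith, by linarith⟩
      · rw [hF, Set.indicator_of_notMem hu, norm_zero]
        exact Set.indicator_nonneg (fun _ _ => by positivity) _
    refine Integrable.mono' ?_ ?_ (Eventually.of_forall hb')
    · exact integrable_indicator_Icc_const _ _ _
    · exact ((Measurable.div (by fun_prop) measurable_id).indicator hSm).aestronglyMeasurable
  have h2 : 2 * ∫ u, F u = ∫ u, (F u + F (-u)) := by
    rw [integral_add hFint hFint.comp_neg, integral_neg_eq_self]; ring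
  have h3 : ‖∫ u, (F u + F (-u))‖ ≤ ∫ u, g u := by
    apply norm_integral_le_of_norm_le
    · exact (integrable_indicator_Icc_const _ _ _).add
        (integrable_indicator_Icc_const _ _ _)
    · refine Eventually.of_forall fun u => ?_
      have g0 : 0 ≤ g u := add_nonneg (Set.indicator_nonneg (fun _ _ => hc0) _)
        (Set.indicator_nonneg (fun _ _ => hc0) _)
      by_cases hu : u ∈ S
      · have hu' : δ < |u| := hu
        have hnu : -u ∈ S := by simpa [hS] using hu'
        have hu0 : 0 < |u| := hδ.trans hu'
        have hun : u ≠ 0 := abs_pos.1 hu0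
        have e : F u + F (-u) = (φ (p + u) - φ (p - u)) / u := by
          rw [hF, Set.indicator_of_mem hu, Set.indicator_of_mem hnu]
          rw [← sub_eq_add_neg]; field_simp; ring
        rw [e, Real.norm_eq_abs, abs_div]
        by_cases hm : u ∈ B₁ ∪ B₂
        · have hcg : c ≤ g u := by
            rcases hm with hm | hm
            · rw [hg]; simp only [Set.indicator_of_mem hm]
              linarith [Set.indicator_nonneg (s := B₂) (f := fun _ => c) (fun _ _ => hc0) u]
            · rw [hg]; simp only [Set.indicator_of_mem hm]
              linarith [Set.indicator_nonneg (s := B₁) (f := fun _ => c) (fun _ _ => hc0) u]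
          refine le_trans ?_ hcg
          have hud : d ≤ |u| + r := by
            rcases hm with hm | hm
            · have := le_abs_self u; linarith [hm.1]
            · have := neg_abs_le u; linarith [hm.2]
          have hA : |φ (p + u) - φ (p - u)| ≤ 2 * M / ε := by
            have := abs_sub (φ (p + u)) (φ (p - u))
            have h1 := hb (p + u); have h2 := hb (p - u)
            calc _ ≤ |φ (p + u)| + |φ (p - u)| := abs_sub _ _
              _ ≤ M / ε + M / ε := add_le_add h1 h2
              _ = _ := by ring
          have hB : |φ (p + u) - φ (p - u)| ≤ 2 * M / ε ^ 2 * |u| := by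
            refine (hL _ _).trans (le_of_eq ?_)
            rw [show p + u - (p - u) = 2 * u by ring, abs_mul, abs_two]; ring
          have hε2 : |φ (p + u) - φ (p - u)| * (ε + |u|) ≤ 4 * M / ε * |u| := by
            have t1 : |φ (p + u) - φ (p - u)| * ε ≤ 2 * M / ε ^ 2 * |u| * ε :=
              mul_le_mul_of_nonneg_right hB hε.le
            have t2 : |φ (p + u) - φ (p - u)| * |u| ≤ 2 * M / ε * |u| :=
              mul_le_mul_of_nonneg_right hA hu0.le
            have t3 : 2 * M / ε ^ 2 * |u| * ε = 2 * M / ε * |u| := by field_simp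
            rw [mul_add]
            calc _ ≤ 2 * M / ε * |u| + 2 * M / ε * |u| := by linarith
              _ = _ := by ring
          rw [div_le_iff₀ hu0]
          have hpos : 0 < ε + |u| := by positivity
          have : ε + d ≤ (1 + R) * (ε + |u|) := by
            have : 0 ≤ R * |u| := by positivity
            rw [hr] at hud; nlinarith
          calc |φ (p + u) - φ (p - u)| ≤ 4 * M / ε * |u| / (ε + |u|) := by
                rw [le_div_iff₀ hpos]; exact hε2
            _ = 4 * M / ε * (1 / (ε + |u|)) * |u| := by ring
            _ ≤ 4 * M / ε * ((1 + R) / (ε + d)) * |u| := by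
                gcongr 4 * M / ε * ?_ * |u|
                rw [div_le_div_iff₀ hpos (by positivity)]; linarith
            _ = c * |u| := by rw [hc]; field_simp
        · have z1 : φ (p + u) = 0 := by
            apply hs
            by_contra h
            push Not at h
            apply hm
            rcases abs_cases (p - q) with h' | h' <;> rw [abs_le] at h
            · right; constructor <;> linarith
            · left; constructor <;> linarith
          have z2 : φ (p - u) = 0 := by
            apply hs
            by_contra h
            push Not at h
            apply hm
            rcases abs_cases (p - q) with h' | h' <;> rw [abs_le] at h
            · left; constructor <;> linarith
            · right; constructor <;> linarith
          rw [z1, z2]; simpa using g0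
      · have hnu : -u ∉ S := by simpa [hS] using hu
        rw [hF, Set.indicator_of_notMem hu, Set.indicator_of_notMem hnu]
        simpa using g0
  have h4 : ∫ u, g u = 4 * r * c := by
    rw [hg, integral_add (integrable_indicator_Icc_const _ _ _)
      (integrable_indicator_Icc_const _ _ _),
      integral_indicator measurableSet_Icc, integral_indicator measurableSet_Icc]
    simp only [integral_const, MeasurableSet.univ, measureReal_restrict_apply, Set.univ_inter,
      smul_eq_mul]
    rw [Real.volume_real_Icc_of_le (by linarith), Real.volume_real_Icc_of_le (by linarith)]; ring
  rw [h1]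
  rw [← h2, h4, Real.norm_eq_abs, abs_mul, abs_two] at h3
  have : 4 * r * c = 2 * (8 * M * R * (1 + R) / (ε + d)) := by
    rw [hc, hr]; field_simp; ring
  linarith

/-- A truncated Hilbert transform, far away from the support of a function of mean zero. -/
lemma abs_truncated_hilbert_le_of_integral_eq_zero {φ : ℝ → ℝ} {M r q p δ : ℝ} (hM : 0 ≤ M)
    (hr : 0 < r) (hφ : Continuous φ) (hb : ∀ s, |φ s| ≤ M)
    (hs : ∀ s, r < |s - q| → φ s = 0) (h0 : ∫ s, φ s = 0) (hp : 2 * r ≤ |p - q|)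
    (hδ : δ < r) :
    |∫ s in {s : ℝ | δ < |s - p|}, φ s / (s - p)| ≤ 4 * M * r ^ 2 / |p - q| ^ 2 := by
  set d := |p - q| with hd
  have hd0 : 0 < d := by linarith
  have hfar : ∀ s, |s - q| ≤ r → d / 2 ≤ |s - p| := by
    intro s h
    have : d ≤ |s - p| + |s - q| := by
      rw [hd, abs_sub_comm s p]
      calc |p - q| = |(p - s) + (s - q)| := by ring_nf
        _ ≤ _ := abs_add_le _ _
    linarith
  have hφint : Integrable φ := by
    refine hφ.integrable_of_hasCompactSupport
      (HasCompactSupport.intro (isCompact_Icc (a := q - r) (b := q + r)) fun s h => hs s ?_)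
    by_contra hh
    push Not at hh
    rw [abs_le] at hh
    exact h ⟨by linarith, by linarith⟩
  have e1 : ∫ s in {s : ℝ | δ < |s - p|}, φ s / (s - p) =
      ∫ s, φ s / (s - p) := by
    apply setIntegral_eq_integral_of_forall_compl_eq_zero
    intro s h
    rw [hs s, zero_div]
    by_contra hh
    push Not at hh
    exact h (lt_of_lt_of_le hδ (by linarith [hfar s hh]))
  have e2 : ∫ s, φ s / (s - p) = ∫ s, (φ s / (s - p) - φ s * (1 / (q - p))) := by
    by_cases hi : Integrable (fun s => φ s / (s - p))
    · rw [integral_sub hi (hφint.mul_const _), integral_mul_const, h0]; ring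
    · have hi' : ¬ Integrable (fun s => φ s / (s - p) - φ s * (1 / (q - p))) := by
        intro h
        apply hi
        refine (h.add (hφint.mul_const (1 / (q - p)))).congr (Eventually.of_forall fun s => ?_)
        simp only [Pi.add_apply, sub_add_cancel]
      rw [integral_undef hi, integral_undef hi']
  rw [e1, e2]
  have e3 : ‖∫ s, (φ s / (s - p) - φ s * (1 / (q - p)))‖ ≤
      ∫ s, (Set.Icc (q - r) (q + r)).indicator (fun _ => M * (r * (2 / d ^ 2))) s := by
    apply norm_integral_le_of_norm_le
    · exact integrable_indicator_Icc_const _ _ _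
    · refine Eventually.of_forall fun s => ?_
      by_cases hm : s ∈ Set.Icc (q - r) (q + r)
      · have hsq : |s - q| ≤ r := abs_le.2 ⟨by linarith [hm.1], by linarith [hm.2]⟩
        have h2 := hfar s hsq
        have hsp : s - p ≠ 0 := abs_pos.1 (by linarith)
        have hqp : q - p ≠ 0 := by
          rw [← abs_pos, abs_sub_comm]; exact hd0
        rw [Set.indicator_of_mem hm, Real.norm_eq_abs]
        have : φ s / (s - p) - φ s * (1 / (q - p)) =
            φ s * ((q - s) * (1 / ((s - p) * (q - p)))) := by field_simp; ring
        rw [this, abs_mul, abs_mul]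
        have h3 : |1 / ((s - p) * (q - p))| ≤ 2 / d ^ 2 := by
          rw [abs_div, abs_mul, abs_one, abs_sub_comm q p, ← hd, div_le_div_iff₀ (by positivity)
            (by positivity)]
          nlinarith
        have := hb s
        rw [abs_sub_comm q s]
        gcongr
      · rw [Set.indicator_of_notMem hm, hs s]
        · simp
        · by_contra hh
          push Not at hh
          rw [abs_le] at hh
          exact hm ⟨by linarith, by linarith⟩
  rw [integral_indicator measurableSet_Icc] at e3
  simp only [integral_const, MeasurableSet.univ, measureReal_restrict_apply, Set.univ_inter,
      smul_eq_mul] at e3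
  rw [Real.volume_real_Icc_of_le (by linarith)] at e3
  refine e3.trans (le_of_eq ?_)
  field_simp; ring

lemma HasCompactSupport.exists_radius {f : ℝ → ℝ} (hf : HasCompactSupport f) :
    ∃ R : ℝ, 1 ≤ R ∧ ∀ s, R < |s| → f s = 0 := by
  obtain ⟨R, hR⟩ := hf.isCompact.isBounded.subset_closedBall (0 : ℝ)
  refine ⟨max R 1, le_max_right _ _, fun s hs => ?_⟩
  by_contra h
  have := hR (subset_tsupport f h)
  rw [Metric.mem_closedBall, dist_zero_right, Real.norm_eq_abs] at this
  exact absurd hs (not_lt.2 (this.trans (le_max_left _ _)))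

lemma abs_sub_le_of_ae_abs_deriv_le {f : ℝ → ℝ} {M : ℝ} (hf : ∀ s, DifferentiableAt ℝ f s)
    (hM : ∀ᵐ s, |deriv f s| ≤ M) (s t : ℝ) : |f s - f t| ≤ M * |s - t| := by
  have hi : IntervalIntegrable (deriv f) volume t s := by
    refine (intervalIntegrable_const (c := M)).mono_fun (measurable_deriv f).aestronglyMeasurable ?_
    refine (ae_restrict_of_ae hM).mono fun u hu => ?_
    exact hu.trans (le_abs_self M)
  rw [← intervalIntegral.integral_eq_sub_of_hasDerivAt (fun u _ => (hf u).hasDerivAt) hi]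
  have := intervalIntegral.norm_integral_le_of_norm_le_const_ae (a := t) (b := s)
    (f := deriv f) (C := M) (hM.mono fun u hu _ => hu)
  simpa using this

lemma continuous_of_abs_sub_le {f : ℝ → ℝ} {M : ℝ} (h : ∀ s t, |f s - f t| ≤ M * |s - t|) :
    Continuous f := by
  have hl : LipschitzWith M.toNNReal f := LipschitzWith.of_dist_le_mul fun s t => by
    rw [Real.dist_eq, Real.dist_eq]
    exact (h s t).trans (mul_le_mul_of_nonneg_right (Real.le_coe_toNNReal M) (abs_nonneg _))
  exact hl.continuous

/-- A decreasing-type primitive of a compactly supported function of mass one. -/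
lemma exists_primitive_of_integral_eq_one {w : ℝ → ℝ} {R : ℝ} (hw : Continuous w) (hR : 0 ≤ R)
    (hs : ∀ s, R < |s| → w s = 0) (h1 : ∫ s, w s = 1) :
    ∃ V : ℝ → ℝ, (∀ s, HasDerivAt V (-w s) s) ∧ (∀ s, R ≤ s → V s = 0) ∧
      (∀ s, s ≤ -R → V s = 1) ∧ ∃ B, 0 ≤ B ∧ ∀ s, |V s| ≤ B := by
  have hd : ∀ s, HasDerivAt (fun s => ∫ u in s..R, w u) (-w s) s := fun s =>
    intervalIntegral.integral_hasDerivAt_left (hw.intervalIntegrable _ _)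
      (hw.stronglyMeasurableAtFilter _ _) hw.continuousAt
  have hright : ∀ s, R ≤ s → ∫ u in s..R, w u = 0 := by
    intro s h
    refine intervalIntegral.integral_zero_ae ?_
    refine Eventually.of_forall fun u hu => ?_
    rw [Set.uIoc_of_ge h] at hu
    exact hs u (lt_of_lt_of_le hu.1 (le_abs_self _))
  have hleft : ∀ s, s ≤ -R → ∫ u in s..R, w u = 1 := by
    intro s h
    have hne : ∀ᵐ u : ℝ, u ≠ -R := by
      simp [ae_iff, measure_singleton]
    rw [intervalIntegral.integral_of_le (by linarith), ← h1, ← integral_indicator measurableSet_Ioc]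
    refine integral_congr_ae (hne.mono fun u hu => ?_)
    by_cases hm : u ∈ Set.Ioc s R
    · simp [hm]
    · rw [Set.indicator_of_notMem hm, hs]
      rw [Set.mem_Ioc, not_and_or] at hm
      rcases hm with hm | hm
      · have : u < -R := lt_of_le_of_ne (by linarith) hu
        exact lt_of_lt_of_le (by linarith) (neg_le_abs u)
      · exact lt_of_lt_of_le (by linarith) (le_abs_self u)
  refine ⟨_, hd, hright, hleft, ?_⟩
  have hc : Continuous fun s => ∫ u in s..R, w u :=
    continuous_iff_continuousAt.2 fun s => (hd s).continuousAt
  obtain ⟨B, hB⟩ := (isCompact_Icc (a := -R) (b := R)).exists_bound_of_continuousOn hc.continuousOn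
  refine ⟨max B 1, le_max_of_le_right zero_le_one, fun s => ?_⟩
  rcases le_or_gt R s with h | h
  · rw [hright s h]; simp
  rcases le_or_gt s (-R) with h' | h'
  · rw [hleft s h']; simp
  · exact (hB s ⟨h'.le, h.le⟩).trans (le_max_left _ _)

lemma card_Icc_ceil_floor_le (s : ℝ) {R : ℝ} (hR : 0 ≤ R) :
    ((Finset.Icc ⌈s - R⌉ ⌊s + R⌋).card : ℝ) ≤ 2 * R + 1 := by
  rw [Int.card_Icc]
  have h1 := Int.floor_le (s + R)
  have h2 := Int.le_ceil (s - R)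
  have h3 : (((⌊s + R⌋ + 1 - ⌈s - R⌉).toNat : ℤ) : ℝ) =
      max ((⌊s + R⌋ + 1 - ⌈s - R⌉ : ℤ) : ℝ) 0 := by
    rw [Int.toNat_eq_max]; push_cast; rfl
  rw [Int.cast_natCast] at h3
  rw [h3]
  refine max_le ?_ (by linarith)
  push_cast; linarith

lemma notMem_Icc_ceil_floor {s R : ℝ} {j : ℤ} (h : j ∉ Finset.Icc ⌈s - R⌉ ⌊s + R⌋) :
    R < |s - j| := by
  by_contra hc
  push Not at hc
  rw [abs_le] at hc
  exact h (Finset.mem_Icc.2 ⟨Int.ceil_le.2 (by linarith), Int.le_floor.2 (by linarith)⟩)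

section Kernel

variable {ψ V : ℝ → ℝ} {R M B : ℝ}

lemma interpolation_term_eq_zero (hψs : ∀ s, R < |s| → ψ s = 0) (q s : ℝ) {j : ℤ}
    (h : j ∉ Finset.Icc ⌈s - R⌉ ⌊s + R⌋) : ψ (s - j) * V (j - q) = 0 := by
  rw [hψs _ (notMem_Icc_ceil_floor h), zero_mul]

lemma abs_interpolation_le (hR : 0 ≤ R) (hM : 0 ≤ M) (hB : 0 ≤ B)
    (hψs : ∀ s, R < |s| → ψ s = 0) (hψb : ∀ s, |ψ s| ≤ M) (hV : ∀ s, |V s| ≤ B) (q s : ℝ) :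
    |∑' j : ℤ, ψ (s - j) * V (j - q)| ≤ (2 * R + 1) * (M * B) := by
  rw [tsum_eq_sum fun j hj => interpolation_term_eq_zero hψs q s hj]
  refine (Finset.abs_sum_le_sum_abs _ _).trans ?_
  refine (Finset.sum_le_card_nsmul _ _ (M * B) fun j _ => ?_).trans ?_
  · rw [abs_mul]; exact mul_le_mul (hψb _) (hV _) (abs_nonneg _) hM
  · rw [nsmul_eq_mul]
    exact mul_le_mul_of_nonneg_right (card_Icc_ceil_floor_le s hR) (by positivity)

lemma abs_interpolation_sub_le (hR : 0 ≤ R) (hM : 0 ≤ M) (hB : 0 ≤ B)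
    (hψs : ∀ s, R < |s| → ψ s = 0) (hψl : ∀ s t, |ψ s - ψ t| ≤ M * |s - t|)
    (hV : ∀ s, |V s| ≤ B) (q s t : ℝ) :
    |∑' j : ℤ, ψ (s - j) * V (j - q) - ∑' j : ℤ, ψ (t - j) * V (j - q)| ≤
      2 * (2 * R + 1) * (M * B) * |s - t| := by
  classical
  set J := Finset.Icc ⌈s - R⌉ ⌊s + R⌋ ∪ Finset.Icc ⌈t - R⌉ ⌊t + R⌋ with hJ
  rw [tsum_eq_sum (s := J) fun j hj => interpolation_term_eq_zero hψs q s
      fun h => hj (Finset.mem_union_left _ h),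
    tsum_eq_sum (s := J) fun j hj => interpolation_term_eq_zero hψs q t
      fun h => hj (Finset.mem_union_right _ h), ← Finset.sum_sub_distrib]
  refine (Finset.abs_sum_le_sum_abs _ _).trans ?_
  refine (Finset.sum_le_card_nsmul _ _ (M * |s - t| * B) fun j _ => ?_).trans ?_
  · rw [← sub_mul, abs_mul]
    refine mul_le_mul ((hψl _ _).trans (le_of_eq ?_)) (hV _) (abs_nonneg _) (by positivity)
    congr 2; ring
  · rw [nsmul_eq_mul]
    have hc : (J.card : ℝ) ≤ 2 * (2 * R + 1) := by
      have := Finset.card_union_le (Finset.Icc ⌈s - R⌉ ⌊s + R⌋) (Finset.Icc ⌈t - R⌉ ⌊t + R⌋)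
      have h' : (J.card : ℝ) ≤ _ := Nat.cast_le.2 this
      push_cast at h'
      linarith [card_Icc_ceil_floor_le s hR, card_Icc_ceil_floor_le t hR]
    calc _ ≤ 2 * (2 * R + 1) * (M * |s - t| * B) := by gcongr
      _ = _ := by ring

/-- The interpolation kernel reproduces constants, so its derivatives sum to zero. -/
lemma tsum_deriv_interpolation_eq_zero {ik : ℝ → ℝ} (hd : ∀ s, DifferentiableAt ℝ ik s)
    (hs : ∀ s, R < |s| → ik s = 0) (hs' : ∀ s, R < |s| → deriv ik s = 0)
    (h1 : ∀ u : ℝ, ∑' j : ℤ, ik (u - j) = 1) (s : ℝ) :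
    ∑' j : ℤ, deriv ik (s - j) = 0 := by
  set J := Finset.Icc ⌈s - (R + 1)⌉ ⌊s + (R + 1)⌋
  have hJ : ∀ u, |u - s| < 1 → ∀ j ∉ J, R < |u - j| := by
    intro u hu j hj
    have h := notMem_Icc_ceil_floor hj
    have : |s - j| ≤ |u - s| + |u - j| := by
      calc |s - (j : ℝ)| = |(s - u) + (u - j)| := by ring_nf
        _ ≤ |s - u| + |u - j| := abs_add_le _ _
        _ = _ := by rw [abs_sub_comm]
    linarith
  rw [tsum_eq_sum fun j hj => hs' _ (hJ s (by simp) j hj)]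
  have hsum : HasDerivAt (fun u => ∑ j ∈ J, ik (u - j)) (∑ j ∈ J, deriv ik (s - j)) s :=
    HasDerivAt.fun_sum fun j _ => (hd (s - j)).hasDerivAt.comp_sub_const s (j : ℝ)
  have hev : (fun u => ∑ j ∈ J, ik (u - j)) =ᶠ[𝓝 s] fun _ => 1 := by
    filter_upwards [Metric.ball_mem_nhds s one_pos] with u hu
    rw [← h1 u, tsum_eq_sum fun j hj => hs _ (hJ u (by simpa [Real.dist_eq] using hu) j hj)]
  exact hsum.unique ((hasDerivAt_const s (1 : ℝ)).congr_of_eventuallyEq hev)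

lemma interpolation_eq_zero (hψs : ∀ s, R < |s| → ψ s = 0)
    (hψ0 : ∀ s : ℝ, ∑' j : ℤ, ψ (s - j) = 0)
    (hV0 : ∀ s, R ≤ s → V s = 0) (hV1 : ∀ s, s ≤ -R → V s = 1) {q s : ℝ}
    (h : 2 * R < |s - q|) : ∑' j : ℤ, ψ (s - j) * V (j - q) = 0 := by
  rcases lt_abs.1 h with h | h
  · have : ∀ j : ℤ, ψ (s - j) * V (j - q) = 0 := by
      intro j
      by_cases hj : R < |s - j|
      · rw [hψs _ hj, zero_mul]
      · push Not at hj
        rw [hV0 _ (by linarith [(abs_le.1 hj).2]), mul_zero]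
    simp [this]
  · rw [← hψ0 s]
    refine tsum_congr fun j => ?_
    by_cases hj : R < |s - j|
    · rw [hψs _ hj, zero_mul]
    · push Not at hj
      rw [hV1 _ (by linarith [(abs_le.1 hj).1]), mul_one]

end Kernel

lemma hasCompactSupport_of_abs_sub {φ : ℝ → ℝ} {r q : ℝ} (hs : ∀ s, r < |s - q| → φ s = 0) :
    HasCompactSupport φ :=
  HasCompactSupport.intro (isCompact_Icc (a := q - r) (b := q + r)) fun s h => hs s <| by
    by_contra hh
    push Not at hh
    rw [abs_le] at hh
    exact h ⟨by linarith, by linarith⟩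

lemma integrableOn_div_sub {φ : ℝ → ℝ} {r q δ : ℝ} (p : ℝ) (hφ : Continuous φ)
    (hs : ∀ s, r < |s - q| → φ s = 0) (hδ : 0 < δ) :
    IntegrableOn (fun s => φ s / (s - p)) {s : ℝ | δ < |s - p|} := by
  have hi : Integrable φ := hφ.integrable_of_hasCompactSupport (hasCompactSupport_of_abs_sub hs)
  refine Integrable.mono' (hi.abs.mul_const δ⁻¹).integrableOn
    (by fun_prop : Measurable fun s => φ s / (s - p)).aestronglyMeasurable ?_
  filter_upwards [ae_restrict_mem (setOf_lt_abs_measurable δ p)] with s h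
  rw [Real.norm_eq_abs, abs_div, div_eq_mul_inv]
  have h' : δ < |s - p| := h
  gcongr

/-- The truncated Hilbert transform at `p` of the interpolation kernel centered at `j ε`. -/
noncomputable def truncKernel (ψ : ℝ → ℝ) (ε δ p : ℝ) (j : ℤ) : ℝ :=
  ∫ s in {s : ℝ | δ < |s - p|}, ε⁻¹ * ψ ((s - j * ε) / ε) / (s - p)

lemma truncated_integral_eq_sum {ik : ℝ → ℝ} {R ε δ : ℝ} (hε : 0 < ε) (hδ : 0 < δ) (p : ℝ)
    (hd : ∀ s, DifferentiableAt ℝ ik s) (hc : Continuous (deriv ik))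
    (hs : ∀ s, R < |s| → deriv ik s = 0) {c : ℤ → ℝ} {J : Finset ℤ} (hJ : ∀ j ∉ J, c j = 0) :
    ∫ s in {s : ℝ | δ < |s - p|},
      deriv (fun s' : ℝ => ∑' j : ℤ, ik ((s' - (j : ℝ) * ε) / ε) * c j) s / (s - p) =
    ∑ j ∈ J, truncKernel (deriv ik) ε δ p j * c j := by
  have h1 : ∀ s, deriv (fun s' : ℝ => ∑' j : ℤ, ik ((s' - (j : ℝ) * ε) / ε) * c j) s =
      ∑ j ∈ J, ε⁻¹ * deriv ik ((s - j * ε) / ε) * c j := by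
    intro s
    have : (fun s' : ℝ => ∑' j : ℤ, ik ((s' - (j : ℝ) * ε) / ε) * c j) =
        fun s' => ∑ j ∈ J, ik ((s' - (j : ℝ) * ε) / ε) * c j := by
      ext s'
      exact tsum_eq_sum fun j hj => by rw [hJ j hj, mul_zero]
    rw [this]
    refine HasDerivAt.deriv (HasDerivAt.fun_sum fun j _ => HasDerivAt.mul_const ?_ _)
    have h := (hd ((s - j * ε) / ε)).hasDerivAt.comp s
      (((hasDerivAt_id s).sub_const ((j : ℝ) * ε)).div_const ε)
    exact h.congr_deriv (by rw [mul_comm, one_div])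
  simp only [h1, truncKernel, Finset.sum_div]
  rw [integral_finsetSum]
  · refine Finset.sum_congr rfl fun j _ => ?_
    rw [← integral_mul_const]
    refine integral_congr_ae (Eventually.of_forall fun s => ?_)
    ring
  · intro j _
    refine integrableOn_div_sub (r := R * ε) (q := j * ε) p (by fun_prop) (fun s h => ?_) hδ
    rw [hs, mul_zero, zero_mul]
    rwa [abs_div, abs_of_pos hε, lt_div_iff₀ hε]

lemma integral_comp_sub_div {ψ : ℝ → ℝ} (c ε : ℝ) (h0 : ∫ s, ψ s = 0) :
    ∫ s, ε⁻¹ * ψ ((s - c) / ε) = 0 := by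
  rw [integral_const_mul, integral_sub_right_eq_self (fun s => ψ (s / ε)) c,
    Measure.integral_comp_div, h0]
  simp

structure KernelData (ψ w V : ℝ → ℝ) (R M B : ℝ) : Prop where
  one_le : 1 ≤ R
  M_nonneg : 0 ≤ M
  B_nonneg : 0 ≤ B
  kernel_support : ∀ s, R < |s| → ψ s = 0
  kernel_bound : ∀ s, |ψ s| ≤ M
  kernel_lipschitz : ∀ s t, |ψ s - ψ t| ≤ M * |s - t|
  kernel_integral : ∫ s, ψ s = 0
  kernel_tsum : ∀ s : ℝ, ∑' j : ℤ, ψ (s - j) = 0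
  aperture_cont : Continuous w
  aperture_support : ∀ s, R < |s| → w s = 0
  aperture_bound : ∀ s, |w s| ≤ B
  primitive_deriv : ∀ s, HasDerivAt V (-w s) s
  primitive_right : ∀ s, R ≤ s → V s = 0
  primitive_left : ∀ s, s ≤ -R → V s = 1
  primitive_bound : ∀ s, |V s| ≤ B

lemma KernelData.of_kernels {w ik : ℝ → ℝ} (hw_supp : HasCompactSupport w)
    (hw : ∀ p, DifferentiableAt ℝ w p) (hw_int : ∫ p, w p = 1)
    (hik_supp : HasCompactSupport ik)
    (hik_d1 : ∀ p : ℝ, DifferentiableAt ℝ ik p)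
    (hik_d2 : ∀ p : ℝ, DifferentiableAt ℝ (deriv ik) p)
    (hik_bdd : ∃ M : ℝ, ∀ᵐ p : ℝ, |deriv (deriv ik) p| ≤ M)
    (hik_exact0 : ∀ u : ℝ, ∑' j : ℤ, ik (u - (j : ℝ)) = 1) :
    ∃ V R M B, KernelData (deriv ik) w V R M B := by
  have hwc : Continuous w := continuous_iff_continuousAt.2 fun s => (hw s).continuousAt
  have hikc : Continuous (deriv ik) :=
    continuous_iff_continuousAt.2 fun s => (hik_d2 s).continuousAt
  obtain ⟨R₁, hR₁, hs₁⟩ := hw_supp.exists_radius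
  obtain ⟨R₂, hR₂, hs₂⟩ := hik_supp.exists_radius
  obtain ⟨R₃, hR₃, hs₃⟩ := hik_supp.deriv.exists_radius
  set R := max R₁ (max R₂ R₃)
  have h1 : R₁ ≤ R := le_max_left _ _
  have h2 : R₂ ≤ R := (le_max_left _ _).trans (le_max_right _ _)
  have h3 : R₃ ≤ R := (le_max_right _ _).trans (le_max_right _ _)
  obtain ⟨V, hV, hVr, hVl, B₁, hB₁, hVb⟩ := exists_primitive_of_integral_eq_one (R := R) hwc
    (by linarith) (fun s h => hs₁ s (h1.trans_lt h)) hw_int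
  obtain ⟨B₂, hB₂⟩ := hw_supp.exists_bound_of_continuous hwc
  obtain ⟨M₁, hM₁⟩ := hik_supp.deriv.exists_bound_of_continuous hikc
  obtain ⟨M₂, hM₂⟩ := hik_bdd
  set B := max B₁ B₂
  set M := max (max M₁ M₂) 0
  refine ⟨V, R, M, B, ?_⟩
  have hsupp : ∀ s, R < |s| → deriv ik s = 0 := fun s h => hs₃ s (h3.trans_lt h)
  exact
  { one_le := hR₁.trans h1
    M_nonneg := le_max_right _ _
    B_nonneg := hB₁.trans (le_max_left _ _)
    kernel_support := hsupp
    kernel_bound := fun s => (hM₁ s).trans ((le_max_left _ _).trans (le_max_left _ _))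
    kernel_lipschitz := fun s t => (abs_sub_le_of_ae_abs_deriv_le hik_d2 hM₂ s t).trans
      (mul_le_mul_of_nonneg_right ((le_max_right _ _).trans (le_max_left _ _)) (abs_nonneg _))
    kernel_integral := integral_eq_zero_of_hasDerivAt_of_integrable
      (fun s => (hik_d1 s).hasDerivAt) (hikc.integrable_of_hasCompactSupport hik_supp.deriv)
      ((continuous_iff_continuousAt.2 fun s =>
        (hik_d1 s).continuousAt).integrable_of_hasCompactSupport hik_supp)
    kernel_tsum := tsum_deriv_interpolation_eq_zero hik_d1 (fun s h => hs₂ s (h2.trans_lt h)) hsupp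
      hik_exact0
    aperture_cont := hwc
    aperture_support := fun s h => hs₁ s (h1.trans_lt h)
    aperture_bound := fun s => (hB₂ s).trans (le_max_right _ _)
    primitive_deriv := hV
    primitive_right := hVr
    primitive_left := hVl
    primitive_bound := fun s => (hVb s).trans (le_max_left _ _) }

namespace KernelData

variable {ψ w V : ℝ → ℝ} {R M B : ℝ}
lemma kernel_cont (D : KernelData ψ w V R M B) : Continuous ψ := continuous_of_abs_sub_le D.kernel_lipschitz

lemma abs_truncKernel_le (D : KernelData ψ w V R M B) {ε δ p : ℝ} {j : ℤ} (hε : 0 < ε) (hδ : δ < ε)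
    (hp : 2 * (R * ε) ≤ |p - j * ε|) :
    |truncKernel ψ ε δ p j| ≤ 4 * M * R ^ 2 * ε / |p - j * ε| ^ 2 := by
  have hR : 0 < R := by linarith [D.one_le]
  have hc := D.kernel_cont
  have h := abs_truncated_hilbert_le_of_integral_eq_zero (φ := fun s => ε⁻¹ * ψ ((s - j * ε) / ε))
    (M := M / ε) (r := R * ε) (q := j * ε) (p := p) (δ := δ) (div_nonneg D.M_nonneg hε.le)
    (by positivity) (by fun_prop) (fun s => ?_) (fun s hs => ?_)
    (integral_comp_sub_div _ _ D.kernel_integral) hp (by nlinarith [D.one_le])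
  · refine h.trans (le_of_eq ?_)
    congr 1; field_simp
  · rw [abs_mul, abs_of_pos (inv_pos.2 hε), mul_comm, ← div_eq_mul_inv]
    exact div_le_div_of_nonneg_right (D.kernel_bound _) hε.le
  · rw [D.kernel_support, mul_zero]
    rwa [abs_div, abs_of_pos hε, lt_div_iff₀ hε]

lemma abs_sum_truncKernel_mul_aperture_le (D : KernelData ψ w V R M B) {ε δ p q : ℝ} (J : Finset ℤ) (hε : 0 < ε) (hδ : δ < ε)
    (hp : 4 * R * ε ≤ |p - q|) :
    |∑ j ∈ J, truncKernel ψ ε δ p j * (ε⁻¹ * w ((j * ε - q) / ε))| ≤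
      16 * (2 * R + 1) * M * R ^ 2 * B / |p - q| ^ 2 := by
  classical
  have hR : 0 < R := by linarith [D.one_le]
  have hM := D.M_nonneg
  have hB := D.B_nonneg
  set I := Finset.Icc ⌈q / ε - R⌉ ⌊q / ε + R⌋
  have hpq : 0 < |p - q| := lt_of_lt_of_le (by positivity) hp
  rw [← Finset.sum_subset (s₁ := J ∩ I) Finset.inter_subset_left]
  · refine (Finset.abs_sum_le_sum_abs _ _).trans ?_
    refine (Finset.sum_le_card_nsmul _ _ (16 * M * R ^ 2 * B / |p - q| ^ 2) fun j hj => ?_).trans ?_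
    · have hj' : |q - j * ε| ≤ R * ε := by
        have := Finset.mem_Icc.1 (Finset.mem_inter.1 hj).2
        have h1 := Int.ceil_le.1 this.1
        have h2 := Int.le_floor.1 this.2
        have e : q = q / ε * ε := by field_simp
        rw [abs_le]
        constructor <;> nlinarith
      have h1 : |p - q| ≤ |p - j * ε| + R * ε := by
        have : |p - q| ≤ |p - j * ε| + |j * ε - q| := abs_sub_le _ _ _
        rw [abs_sub_comm (j * ε) q] at this; linarith
      have h2 : |p - q| / 2 ≤ |p - j * ε| := by linarith
      have h3 := D.abs_truncKernel_le hε hδ (show 2 * (R * ε) ≤ |p - j * ε| by linarith)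
      rw [abs_mul, abs_mul, abs_of_pos (inv_pos.2 hε)]
      calc _ ≤ 4 * M * R ^ 2 * ε / (|p - q| / 2) ^ 2 * (ε⁻¹ * B) := by
            gcongr
            · exact h3.trans (by gcongr)
            · exact D.aperture_bound _
        _ = _ := by field_simp; ring
    · rw [nsmul_eq_mul]
      have : ((J ∩ I).card : ℝ) ≤ 2 * R + 1 :=
        (Nat.cast_le.2 (Finset.card_le_card Finset.inter_subset_right)).trans
          (card_Icc_ceil_floor_le _ hR.le)
      calc _ ≤ (2 * R + 1) * (16 * M * R ^ 2 * B / |p - q| ^ 2) := by gcongr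
        _ = _ := by ring
  · intro j hj hj'
    have : j ∉ I := fun h => hj' (Finset.mem_inter.2 ⟨hj, h⟩)
    rw [D.aperture_support, mul_zero, mul_zero]
    have h := notMem_Icc_ceil_floor this
    rw [abs_sub_comm] at h
    rwa [sub_div, mul_div_assoc, div_self hε.ne', mul_one]

lemma abs_truncated_interpolation_le (D : KernelData ψ w V R M B) {ε δ : ℝ} (p q : ℝ) (hε : 0 < ε) (hδ : 0 < δ) :
    (IntegrableOn (fun s => ε⁻¹ * (∑' j : ℤ, ψ (s / ε - j) * V (j - q / ε)) / (s - p))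
      {s : ℝ | δ < |s - p|}) ∧
    |∫ s in {s : ℝ | δ < |s - p|}, ε⁻¹ * (∑' j : ℤ, ψ (s / ε - j) * V (j - q / ε)) / (s - p)| ≤
      8 * (2 * (2 * R + 1) * (M * B)) * (2 * R) * (1 + 2 * R) / (ε + |p - q|) := by
  have hR : 0 < R := by linarith [D.one_le]
  have hM := D.M_nonneg
  have hB := D.B_nonneg
  have hl := abs_interpolation_sub_le hR.le hM hB D.kernel_support D.kernel_lipschitz
    D.primitive_bound (q / ε)
  have hc := continuous_of_abs_sub_le hl
  have hcont : Continuous fun s => ε⁻¹ * (∑' j : ℤ, ψ (s / ε - j) * V (j - q / ε)) :=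
    continuous_const.mul (hc.comp (continuous_id.div_const ε))
  have hs : ∀ s, 2 * R * ε < |s - q| → ε⁻¹ * (∑' j : ℤ, ψ (s / ε - j) * V (j - q / ε)) = 0 := by
    intro s h
    rw [interpolation_eq_zero D.kernel_support D.kernel_tsum D.primitive_right D.primitive_left,
      mul_zero]
    rwa [← sub_div, abs_div, abs_of_pos hε, lt_div_iff₀ hε]
  refine ⟨integrableOn_div_sub p hcont hs hδ, ?_⟩
  refine abs_truncated_hilbert_le (by positivity) (by positivity) hε hδ hcont (fun s => ?_)
    (fun s t => ?_) hs
  · rw [abs_mul, abs_of_pos (inv_pos.2 hε), mul_comm, ← div_eq_mul_inv]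
    refine div_le_div_of_nonneg_right ?_ hε.le
    refine (abs_interpolation_le hR.le hM hB D.kernel_support D.kernel_bound D.primitive_bound
      _ _).trans ?_
    have : 0 ≤ (2 * R + 1) * (M * B) := by positivity
    linarith
  · rw [← mul_sub, abs_mul, abs_of_pos (inv_pos.2 hε)]
    calc _ ≤ ε⁻¹ * (2 * (2 * R + 1) * (M * B) * |s / ε - t / ε|) := by gcongr; exact hl _ _
      _ = _ := by rw [← sub_div, abs_div, abs_of_pos hε]; field_simp

/-- The response of the reconstruction operator to a half-line, up to a constant. -/
lemma exists_response (D : KernelData ψ w V R M B) {ε δ p Q : ℝ} {N : ℤ} (hε : 0 < ε) (hδ : 0 < δ)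
    (hp : |p| ≤ Q) (hN : 3 * Q / ε + R ≤ N) :
    ∃ A : ℝ → ℝ,
      (∀ q, HasDerivAt A (∑ j ∈ Finset.Icc (-N) N,
        truncKernel ψ ε δ p j * (ε⁻¹ * w ((j * ε - q) / ε))) q) ∧
      ∀ q, |q| ≤ Q → |A q| ≤
        2 * (8 * (2 * (2 * R + 1) * (M * B)) * (2 * R) * (1 + 2 * R)) / (ε + |p - q|) := by
  have hR : 0 < R := by linarith [D.one_le]
  have hM := D.M_nonneg
  have hB := D.B_nonneg
  have hQ : 0 ≤ Q := (abs_nonneg p).trans hp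
  have hcont := D.kernel_cont
  refine ⟨fun q => ∑ j ∈ Finset.Icc (-N) N,
    truncKernel ψ ε δ p j * (V ((j * ε - q) / ε) - V (j - 3 * Q / ε)), fun q => ?_, fun q hq => ?_⟩
  · refine HasDerivAt.fun_sum fun j _ => HasDerivAt.const_mul _ (HasDerivAt.sub_const _ ?_)
    have h := (D.primitive_deriv ((j * ε - q) / ε)).comp q
      (((hasDerivAt_id q).const_sub ((j : ℝ) * ε)).div_const ε)
    exact h.congr_deriv (by rw [div_eq_mul_inv]; ring)
  · have hV : ∀ q', |q'| ≤ 3 * Q → ∀ j : ℤ, j ∉ Finset.Icc (-N) N →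
        V (j - q' / ε) = if 0 < j then 0 else 1 := by
      intro q' hq' j hj
      have hq2 : |q' / ε| ≤ 3 * Q / ε := by
        rw [abs_div, abs_of_pos hε]; gcongr
      rw [abs_le] at hq2
      have hN0 : (0 : ℝ) ≤ N := by
        have : 0 ≤ 3 * Q / ε := by positivity
        linarith
      have hN0' : 0 ≤ N := by exact_mod_cast hN0
      rw [Finset.mem_Icc, not_and_or] at hj
      split_ifs with h
      · have hj' : N < j := by omega
        have : (N : ℝ) < j := by exact_mod_cast hj'
        exact D.primitive_right _ (by linarith)
      · have hj' : j < -N := by omega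
        have : (j : ℝ) < -N := by exact_mod_cast hj'
        exact D.primitive_left _ (by linarith)
    have hsum : ∀ q' s, Summable fun j : ℤ => ψ (s / ε - j) * V (j - q' / ε) := fun q' s =>
      summable_of_ne_finset_zero fun j hj => interpolation_term_eq_zero D.kernel_support _ _ hj
    have hq0 : |3 * Q| ≤ 3 * Q := by rw [abs_of_nonneg (by positivity)]
    obtain ⟨i1, b1⟩ := D.abs_truncated_interpolation_le p q hε hδ
    obtain ⟨i2, b2⟩ := D.abs_truncated_interpolation_le p (3 * Q) hε hδ
    have key : ∑ j ∈ Finset.Icc (-N) N,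
        truncKernel ψ ε δ p j * (V ((j * ε - q) / ε) - V (j - 3 * Q / ε)) =
        (∫ s in {s : ℝ | δ < |s - p|},
          ε⁻¹ * (∑' j : ℤ, ψ (s / ε - j) * V (j - q / ε)) / (s - p)) -
        ∫ s in {s : ℝ | δ < |s - p|},
          ε⁻¹ * (∑' j : ℤ, ψ (s / ε - j) * V (j - 3 * Q / ε)) / (s - p) := by
      rw [← integral_sub i1 i2]
      simp only [truncKernel, ← integral_mul_const]
      rw [← integral_finsetSum]
      · refine integral_congr_ae (Eventually.of_forall fun s => ?_)
        simp only
        rw [← sub_div, ← mul_sub, ← (hsum q s).tsum_sub (hsum (3 * Q) s),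
          tsum_eq_sum (s := Finset.Icc (-N) N), Finset.mul_sum, Finset.sum_div]
        · refine Finset.sum_congr rfl fun j _ => ?_
          rw [sub_div, sub_div, mul_div_cancel_right₀ _ hε.ne']
          ring
        · intro j hj
          rw [hV q (by linarith) j hj, hV (3 * Q) hq0 j hj, sub_self]
      · intro j _
        refine Integrable.mul_const ?_ _
        refine integrableOn_div_sub (r := R * ε) (q := j * ε) p (by fun_prop) (fun s h => ?_) hδ
        rw [D.kernel_support, mul_zero]
        rwa [abs_div, abs_of_pos hε, lt_div_iff₀ hε]
    simp only
    rw [key]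
    refine (abs_sub _ _).trans ((add_le_add b1 b2).trans ?_)
    have hpq : |p - q| ≤ |p - 3 * Q| := by
      have h1 : |p - q| ≤ 2 * Q := (abs_sub _ _).trans (by linarith)
      have h2 : 2 * Q ≤ 3 * Q - p := by linarith [(abs_le.1 hp).2]
      rw [abs_sub_comm p (3 * Q)]
      exact h1.trans (h2.trans (le_abs_self _))
    set c := 8 * (2 * (2 * R + 1) * (M * B)) * (2 * R) * (1 + 2 * R)
    have hc0 : 0 ≤ c := by positivity
    rw [mul_div_assoc 2 c, two_mul (c / _)]
    gcongr

end KernelData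

lemma sum_one_div_one_add_abs_le {N : ℕ} {S : Finset ℤ} (hS : S ⊆ Finset.Icc (-N : ℤ) N) :
    ∑ m ∈ S, 1 / (1 + |(m : ℝ)|) ≤ 2 * (1 + Real.log (N + 1)) := by
  have h1 : ∑ i ∈ Finset.range (N + 1), 1 / (1 + (i : ℝ)) ≤ 1 + Real.log (N + 1) := by
    have := harmonic_le_one_add_log (N + 1)
    rw [harmonic] at this
    push_cast at this
    refine le_trans (le_of_eq ?_) this
    exact Finset.sum_congr rfl fun i _ => by rw [one_div, add_comm]
  have h2 : ∑ m ∈ S, 1 / (1 + |(m : ℝ)|) ≤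
      ∑ m ∈ (Finset.range (N + 1)).image (fun i : ℕ => (i : ℤ)) ∪
        (Finset.range (N + 1)).image (fun i : ℕ => -(i : ℤ)), 1 / (1 + |(m : ℝ)|) := by
    refine Finset.sum_le_sum_of_subset_of_nonneg (fun m hm => ?_) fun _ _ _ => by positivity
    have := Finset.mem_Icc.1 (hS hm)
    rw [Finset.mem_union, Finset.mem_image, Finset.mem_image]
    rcases le_total 0 m with h | h
    · exact Or.inl ⟨m.toNat, Finset.mem_range.2 (by omega), by omega⟩
    · exact Or.inr ⟨(-m).toNat, Finset.mem_range.2 (by omega), by omega⟩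
  refine h2.trans ((Finset.sum_union_inter (f := fun m : ℤ => 1 / (1 + |(m : ℝ)|)) ▸
    le_add_of_nonneg_right (Finset.sum_nonneg fun _ _ => by positivity)).trans ?_)
  rw [Finset.sum_image (fun i _ j _ h => by simpa using h),
    Finset.sum_image (fun i _ j _ h => by simpa using h)]
  simp only [Int.cast_natCast, Int.cast_neg, abs_neg, Nat.abs_cast]
  linarith

lemma sum_one_div_add_abs_sub_le {κ c : ℝ} (hκ : 0 < κ) (hc : 0 < c) :
    ∃ C : ℝ, 0 < C ∧ ∀ ε : ℝ, 0 < ε → ε < Real.exp (-1) → ∀ τ : ℝ, |τ| ≤ 4 * Real.pi →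
      ∀ K : Finset ℤ, (∀ k ∈ K, |(k : ℝ) * (κ * ε)| ≤ Real.pi / 2) →
        ∑ k ∈ K, 1 / (ε + c * |(k : ℝ) * (κ * ε) - τ|) ≤ C * (ε⁻¹ * Real.log (1 / ε)) := by
  set a := c * κ with ha
  have ha0 : 0 < a := by positivity
  set L := Real.log (5 * Real.pi / κ + 3) with hL
  have hpi := Real.pi_pos
  have hL0 : 0 ≤ L := Real.log_nonneg (by
    have : 0 ≤ 5 * Real.pi / κ := by positivity
    linarith)
  refine ⟨max 2 (1 / a) * (2 * (2 + L)), by positivity, fun ε hε hε1 τ hτ K hK => ?_⟩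
  have hε1' : ε < 1 := hε1.trans (by rw [← Real.exp_zero]; exact Real.exp_lt_exp.2 (by norm_num))
  have hlog : 1 ≤ Real.log (1 / ε) := by
    rw [one_div, Real.log_inv]
    have := Real.log_lt_log hε hε1
    rw [Real.log_exp] at this; linarith
  set τ' := τ / (κ * ε) with hτ'
  set k₀ := ⌊τ'⌋ with hk₀
  have hf1 := Int.floor_le τ'
  have hf2 := Int.lt_floor_add_one τ'
  set N := ⌈5 * Real.pi / (κ * ε) + 1⌉₊ with hN
  have hNle : 5 * Real.pi / (κ * ε) + 1 ≤ N := Nat.le_ceil _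
  have hNlt : (N : ℝ) < 5 * Real.pi / (κ * ε) + 1 + 1 := Nat.ceil_lt_add_one (by positivity)
  have hτb : |τ'| ≤ 4 * Real.pi / (κ * ε) := by
    rw [hτ', abs_div, abs_of_pos (by positivity : 0 < κ * ε)]; gcongr
  have hterm : ∀ k ∈ K, 1 / (ε + c * |(k : ℝ) * (κ * ε) - τ|) ≤
      ε⁻¹ * max 2 (1 / a) * (1 / (1 + |((k - k₀ : ℤ) : ℝ)|)) := by
    intro k _
    have e : ε + c * |(k : ℝ) * (κ * ε) - τ| = ε * (1 + a * |k - τ'|) := by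
      have : (k : ℝ) * (κ * ε) - τ = (k - τ') * (κ * ε) := by
        rw [hτ']; field_simp
      rw [this, abs_mul, abs_of_pos (by positivity : 0 < κ * ε), ha]; ring
    have h1 : |((k - k₀ : ℤ) : ℝ)| ≤ |k - τ'| + 1 := by
      have : |((k - k₀ : ℤ) : ℝ)| ≤ |k - τ'| + |τ' - k₀| := by
        push_cast; exact abs_sub_le _ _ _
      have h2 : |τ' - k₀| ≤ 1 := abs_le.2 ⟨by linarith, by linarith⟩
      linarith
    have h2 : 1 + |((k - k₀ : ℤ) : ℝ)| ≤ max 2 (1 / a) * (1 + a * |k - τ'|) := by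
      have m1 : 2 ≤ max 2 (1 / a) := le_max_left _ _
      have m2 : 1 ≤ max 2 (1 / a) * a := by
        have := mul_le_mul_of_nonneg_right (le_max_right 2 (1 / a)) ha0.le
        rwa [one_div, inv_mul_cancel₀ ha0.ne', ← one_div] at this
      nlinarith [abs_nonneg ((k : ℝ) - τ')]
    rw [e, one_div, mul_inv, mul_assoc ε⁻¹, ← one_div (1 + _)]
    refine mul_le_mul_of_nonneg_left ?_ (inv_nonneg.2 hε.le)
    rw [mul_one_div, div_le_div_iff₀ (by positivity) (by positivity)]
    linarith
  refine (Finset.sum_le_sum hterm).trans ?_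
  rw [← Finset.mul_sum]
  have hsum : ∑ k ∈ K, 1 / (1 + |((k - k₀ : ℤ) : ℝ)|) ≤ 2 * (1 + Real.log (N + 1)) := by
    rw [← Finset.sum_image (f := fun m : ℤ => 1 / (1 + |(m : ℝ)|)) (g := fun k => k - k₀)
      (fun i _ j _ h => by simpa using h)]
    apply sum_one_div_one_add_abs_le
    intro m hm
    obtain ⟨k, hk, rfl⟩ := Finset.mem_image.1 hm
    have h1 := hK k hk
    have h2 : |(k : ℝ)| ≤ Real.pi / (κ * ε) := by
      rw [abs_mul, abs_of_pos (by positivity : 0 < κ * ε)] at h1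
      rw [le_div_iff₀ (by positivity)]; linarith
    have h3 : (5 : ℝ) * Real.pi / (κ * ε) = 4 * Real.pi / (κ * ε) + Real.pi / (κ * ε) := by ring
    rw [abs_le] at h2 hτb
    have l1 : -(N : ℝ) ≤ ((k - k₀ : ℤ) : ℝ) := by push_cast; linarith
    have l2 : ((k - k₀ : ℤ) : ℝ) ≤ (N : ℝ) := by push_cast; linarith
    exact Finset.mem_Icc.2 ⟨by exact_mod_cast l1, by exact_mod_cast l2⟩
  have hlogN : Real.log (N + 1) ≤ L + Real.log (1 / ε) := by
    rw [hL, ← Real.log_mul (by positivity) (by positivity)]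
    apply Real.log_le_log (by positivity)
    have : (5 * Real.pi / κ + 3) * (1 / ε) = 5 * Real.pi / (κ * ε) + 3 / ε := by field_simp
    rw [this]
    have : 3 ≤ 3 / ε := by rw [le_div_iff₀ hε]; linarith
    linarith
  calc _ ≤ ε⁻¹ * max 2 (1 / a) * (2 * (1 + (L + Real.log (1 / ε)))) := by gcongr; linarith
    _ ≤ ε⁻¹ * max 2 (1 / a) * (2 * ((2 + L) * Real.log (1 / ε))) := by
        gcongr; nlinarith
    _ = _ := by ring

lemma exists_polar (v : ℝ × ℝ) :
    ∃ β : ℝ, |β| ≤ Real.pi ∧ ∀ α, dot2 (vec α) v =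
      Real.sqrt (v.1 ^ 2 + v.2 ^ 2) * Real.cos (α - β) := by
  refine ⟨Complex.arg ⟨v.1, v.2⟩, Complex.abs_arg_le_pi _, fun α => ?_⟩
  have hn : ‖(⟨v.1, v.2⟩ : ℂ)‖ = Real.sqrt (v.1 ^ 2 + v.2 ^ 2) := by
    rw [Complex.norm_def, Complex.normSq_mk]; congr 1; ring
  have h1 := Complex.norm_mul_cos_arg ⟨v.1, v.2⟩
  have h2 := Complex.norm_mul_sin_arg ⟨v.1, v.2⟩
  rw [hn] at h1 h2
  rw [Real.cos_sub, dot2, vec]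
  simp only at h1 h2 ⊢
  linear_combination (-Real.cos α) * h1 - Real.sin α * h2

lemma exists_int_abs_sub_le_abs_sin {u : ℝ} (hu : |u| ≤ 2 * Real.pi) :
    ∃ m ∈ Finset.Icc (-2 : ℤ) 2, 2 / Real.pi * |u - m * Real.pi| ≤ |Real.sin u| := by
  have hpi := Real.pi_pos
  set m := round (u / Real.pi) with hm
  have h1 := abs_sub_round (u / Real.pi)
  rw [← hm] at h1
  have h2 : |u - m * Real.pi| ≤ Real.pi / 2 := by
    have : u - m * Real.pi = (u / Real.pi - m) * Real.pi := by field_simp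
    rw [this, abs_mul, abs_of_pos hpi]; nlinarith
  refine ⟨m, ?_, ?_⟩
  · have h3 : |u / Real.pi| ≤ 2 := by
      rw [abs_div, abs_of_pos hpi, div_le_iff₀ hpi]; exact hu
    rw [abs_le] at h1 h3
    have l1 : (-3 : ℝ) < m := by linarith
    have l2 : (m : ℝ) < 3 := by linarith
    have l1' : -3 < m := by exact_mod_cast l1
    have l2' : m < 3 := by exact_mod_cast l2
    exact Finset.mem_Icc.2 ⟨by omega, by omega⟩
  · refine (Real.mul_abs_le_abs_sin h2).trans (le_of_eq ?_)
    rw [Real.sin_sub_int_mul_pi, abs_mul, abs_zpow, abs_neg, abs_one, one_zpow, one_mul]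

/-- The angular sum of the response to a point at distance at least `d`. -/
lemma sum_one_div_add_abs_dot2_le {κ d : ℝ} (hκ : 0 < κ) (hd : 0 < d) :
    ∃ C : ℝ, 0 < C ∧ ∀ ε : ℝ, 0 < ε → ε < Real.exp (-1) → ∀ v : ℝ × ℝ,
      d ≤ Real.sqrt (v.1 ^ 2 + v.2 ^ 2) →
      ∀ K : Finset ℤ, (∀ k ∈ K, |(k : ℝ) * (κ * ε)| ≤ Real.pi / 2) →
        ∑ k ∈ K, 1 / (ε + |dot2 (vec ((k : ℝ) * (κ * ε))) v|) ≤ C * (ε⁻¹ * Real.log (1 / ε)) := by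
  have hpi := Real.pi_pos
  obtain ⟨C, hC, h⟩ := sum_one_div_add_abs_sub_le (c := 2 * d / Real.pi) hκ (by positivity)
  refine ⟨5 * C, by positivity, fun ε hε hε1 v hv K hK => ?_⟩
  obtain ⟨β, hβ, hdot⟩ := exists_polar v
  set τ : ℤ → ℝ := fun m => β - Real.pi / 2 + m * Real.pi with hτ
  have hβ' := abs_le.1 hβ
  have hterm : ∀ k ∈ K, 1 / (ε + |dot2 (vec ((k : ℝ) * (κ * ε))) v|) ≤
      ∑ m ∈ Finset.Icc (-2 : ℤ) 2, 1 / (ε + 2 * d / Real.pi * |(k : ℝ) * (κ * ε) - τ m|) := by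
    intro k hk
    have hα := abs_le.1 (hK k hk)
    set α := (k : ℝ) * (κ * ε)
    obtain ⟨m, hm, hle⟩ := exists_int_abs_sub_le_abs_sin (u := α - (β - Real.pi / 2))
      (abs_le.2 ⟨by linarith, by linarith⟩)
    refine le_trans ?_ (Finset.single_le_sum (f := fun m : ℤ =>
      1 / (ε + 2 * d / Real.pi * |α - τ m|)) (fun _ _ => by positivity) hm)
    gcongr
    rw [hdot, abs_mul, abs_of_nonneg (Real.sqrt_nonneg _), ← Real.sin_add_pi_div_two]
    rw [show α - (β - Real.pi / 2) - m * Real.pi = α - τ m by rw [hτ]; ring,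
      show α - (β - Real.pi / 2) = α - β + Real.pi / 2 by ring] at hle
    calc 2 * d / Real.pi * |α - τ m| = d * (2 / Real.pi * |α - τ m|) := by ring
      _ ≤ _ := mul_le_mul hv hle (by positivity) (by positivity)
  refine (Finset.sum_le_sum hterm).trans ?_
  rw [Finset.sum_comm]
  refine (Finset.sum_le_card_nsmul _ _ (C * (ε⁻¹ * Real.log (1 / ε))) fun m hm => ?_).trans ?_
  · refine h ε hε hε1 (τ m) ?_ K hK
    have hm' := Finset.mem_Icc.1 hm
    have m1 : (-2 : ℝ) ≤ m := by exact_mod_cast hm'.1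
    have m2 : (m : ℝ) ≤ 2 := by exact_mod_cast hm'.2
    rw [abs_le]
    constructor <;> simp only [hτ] <;> nlinarith
  · simp; linarith

/-- On an interval without zeros of `h` the cut-off integral of a derivative is trivial or
telescopes. -/
lemma abs_integral_ite_deriv_le_of_ne_zero {h φ φ' : ℝ → ℝ} {a b B : ℝ} (hab : a ≤ b)
    (hh : Continuous h) (hφ : ∀ s ∈ Set.Icc a b, HasDerivAt φ (φ' s) s)
    (hφ' : ContinuousOn φ' (Set.Icc a b)) (hB : ∀ s ∈ Set.Icc a b, |φ s| ≤ B)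
    (hne : ∀ s ∈ Set.Ioo a b, h s ≠ 0) :
    |∫ s in a..b, if 0 < h s then φ' s else 0| ≤ 2 * B := by
  have hB0 : 0 ≤ B := (abs_nonneg _).trans (hB a ⟨le_rfl, hab⟩)
  have hsign : (∀ s ∈ Set.Ioo a b, 0 < h s) ∨ (∀ s ∈ Set.Ioo a b, ¬ 0 < h s) := by
    by_contra! hcon
    obtain ⟨⟨s, hs, hs0⟩, u, hu, hu0⟩ := hcon
    obtain ⟨z, hz, hz0⟩ := isPreconnected_Ioo.intermediate_value hs hu hh.continuousOn
      (⟨hs0, hu0.le⟩ : (0 : ℝ) ∈ Set.Icc (h s) (h u))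
    exact hne z hz hz0
  rcases hsign with hp | hn
  · have : ∫ s in a..b, (if 0 < h s then φ' s else 0) = ∫ s in a..b, φ' s := by
      rw [intervalIntegral.integral_of_le hab, intervalIntegral.integral_of_le hab,
        integral_Ioc_eq_integral_Ioo, integral_Ioc_eq_integral_Ioo]
      exact setIntegral_congr_fun measurableSet_Ioo fun s hs => if_pos (hp s hs)
    rw [this, intervalIntegral.integral_eq_sub_of_hasDerivAt
      (by rwa [Set.uIcc_of_le hab]) (ContinuousOn.intervalIntegrable_of_Icc hab hφ')]
    have h1 := hB a ⟨le_rfl, hab⟩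
    have h2 := hB b ⟨hab, le_rfl⟩
    have := abs_sub (φ b) (φ a)
    linarith
  · have : ∫ s in a..b, (if 0 < h s then φ' s else 0) = 0 := by
      rw [intervalIntegral.integral_of_le hab, integral_Ioc_eq_integral_Ioo]
      exact setIntegral_eq_zero_of_forall_eq_zero fun s hs => if_neg (hn s hs)
    rw [this, abs_zero]; positivity

lemma intervalIntegrable_ite_pos {h φ : ℝ → ℝ} {a b : ℝ} (hab : a ≤ b)
    (hh : Continuous h) (hφ : ContinuousOn φ (Set.Icc a b)) :
    IntervalIntegrable (fun s => if 0 < h s then φ s else 0) volume a b := by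
  have h1 := (ContinuousOn.intervalIntegrable_of_Icc hab hφ (μ := volume))
  rw [intervalIntegrable_iff] at h1 ⊢
  exact h1.indicator (isOpen_lt continuous_const hh).measurableSet

/-- Integral of a derivative over the positivity set of a function with finitely many zeros. -/
lemma abs_integral_ite_deriv_le {h φ φ' : ℝ → ℝ} {B : ℝ} (hh : Continuous h) {n : ℕ} :
    ∀ {a b : ℝ}, a ≤ b → (∀ s ∈ Set.Icc a b, HasDerivAt φ (φ' s) s) →
    ContinuousOn φ' (Set.Icc a b) → (∀ s ∈ Set.Icc a b, |φ s| ≤ B) →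
    {s ∈ Set.Ioo a b | h s = 0}.Finite → {s ∈ Set.Ioo a b | h s = 0}.ncard = n →
    |∫ s in a..b, if 0 < h s then φ' s else 0| ≤ 2 * (n + 1) * B := by
  induction n using Nat.strong_induction_on with
  | _ n ih =>
    intro a b hab hφ hφ' hB hfin hcard
    rcases Set.eq_empty_or_nonempty {s ∈ Set.Ioo a b | h s = 0} with hemp | ⟨z, hz, hz0⟩
    · rw [hemp, Set.ncard_empty] at hcard
      refine (abs_integral_ite_deriv_le_of_ne_zero hab hh hφ hφ' hB fun s hs h0 => ?_).trans ?_
      · exact (hemp ▸ (⟨hs, h0⟩ : s ∈ {s ∈ Set.Ioo a b | h s = 0}) : s ∈ (∅ : Set ℝ))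
      · rw [← hcard]; simp
    · have s1 : Set.Icc a z ⊆ Set.Icc a b := Set.Icc_subset_Icc_right hz.2.le
      have s2 : Set.Icc z b ⊆ Set.Icc a b := Set.Icc_subset_Icc_left hz.1.le
      set Z := {s ∈ Set.Ioo a b | h s = 0}
      set Z₁ := {s ∈ Set.Ioo a z | h s = 0}
      set Z₂ := {s ∈ Set.Ioo z b | h s = 0}
      have z1 : Z₁ ⊆ Z := fun s hs => ⟨⟨hs.1.1, hs.1.2.trans hz.2⟩, hs.2⟩
      have z2 : Z₂ ⊆ Z := fun s hs => ⟨⟨hz.1.trans hs.1.1, hs.1.2⟩, hs.2⟩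
      have hf1 := hfin.subset z1
      have hf2 := hfin.subset z2
      have hdisj : Disjoint Z₁ Z₂ := Set.disjoint_left.2 fun s h1 h2 =>
        absurd h1.1.2 (not_lt.2 h2.1.1.le)
      have hle : Z₁.ncard + Z₂.ncard + 1 ≤ n := by
        rw [← hcard, ← Set.ncard_union_eq hdisj hf1 hf2, ← Set.ncard_insert_of_notMem
          (a := z) (s := Z₁ ∪ Z₂) (by
            rintro (h | h)
            · exact lt_irrefl _ h.1.2
            · exact lt_irrefl _ h.1.1) (hf1.union hf2)]
        refine Set.ncard_le_ncard ?_ hfin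
        exact Set.insert_subset ⟨hz, hz0⟩ (Set.union_subset z1 z2)
      have i1 := ih Z₁.ncard (by omega) hz.1.le (fun s hs => hφ s (s1 hs)) (hφ'.mono s1)
        (fun s hs => hB s (s1 hs)) hf1 rfl
      have i2 := ih Z₂.ncard (by omega) hz.2.le (fun s hs => hφ s (s2 hs)) (hφ'.mono s2)
        (fun s hs => hB s (s2 hs)) hf2 rfl
      have hB0 : 0 ≤ B := (abs_nonneg _).trans (hB a ⟨le_rfl, hab⟩)
      rw [← intervalIntegral.integral_add_adjacent_intervals
        (intervalIntegrable_ite_pos hz.1.le hh (hφ'.mono s1))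
        (intervalIntegrable_ite_pos hz.2.le hh (hφ'.mono s2))]
      refine (abs_add_le _ _).trans ((add_le_add i1 i2).trans ?_)
      have : ((Z₁.ncard : ℝ) + Z₂.ncard + 1) ≤ n := by exact_mod_cast hle
      nlinarith

lemma hasDerivAt_dot2 {Y : ℝ → ℝ × ℝ} {Y' : ℝ × ℝ} {θ : ℝ} (u : ℝ × ℝ) (h : HasDerivAt Y Y' θ) :
    HasDerivAt (fun θ => dot2 u (Y θ)) (dot2 u Y') θ :=
  (((hasFDerivAt_fst (p := Y θ)).comp_hasDerivAt θ h).const_mul u.1).add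
    (((hasFDerivAt_snd (p := Y θ)).comp_hasDerivAt θ h).const_mul u.2)

lemma continuous_dot2 (u : ℝ × ℝ) : Continuous (dot2 u) := by
  unfold dot2; fun_prop

lemma abs_integral_ite_le {h φ : ℝ → ℝ} {a b B : ℝ} (hab : a ≤ b)
    (hB : ∀ s ∈ Set.Icc a b, |φ s| ≤ B) :
    |∫ s in a..b, if 0 < h s then φ s else 0| ≤ B * (b - a) := by
  have hB0 : 0 ≤ B := (abs_nonneg _).trans (hB a ⟨le_rfl, hab⟩)
  have := intervalIntegral.norm_integral_le_of_norm_le_const (a := a) (b := b) (C := B)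
    (f := fun s => if 0 < h s then φ s else 0) (fun s hs => by
      rw [Set.uIoc_of_le hab] at hs
      split_ifs
      · exact hB s ⟨hs.1.le, hs.2⟩
      · simpa using hB0)
  rwa [Real.norm_eq_abs, abs_of_nonneg (sub_nonneg.2 hab)] at this

/-- Summed slice estimate in which the phases are all non-stationary along the curve: one
integration by parts, each zero of `h` contributing two boundary terms. -/
lemma abs_integral_ite_transversal_le {ι : Type*} (K : Finset ι) {h G G' : ℝ → ℝ}
    {Y Y' Y'' : ℝ → ℝ × ℝ} {u : ι → ℝ × ℝ} {A A' : ι → ℝ → ℝ} {σ : ι → ℝ} {a b c M S : ℝ} {n : ℕ}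
    (hab : a ≤ b) (hc : 0 < c) (hM : 0 ≤ M) (hh : Continuous h)
    (hfin : {s ∈ Set.Ioo a b | h s = 0}.Finite) (hcard : {s ∈ Set.Ioo a b | h s = 0}.ncard = n)
    (hG : ∀ s, HasDerivAt G (G' s) s) (hG' : Continuous G')
    (hY : ∀ s, HasDerivAt Y (Y' s) s) (hY' : ∀ s, HasDerivAt Y' (Y'' s) s) (hY'' : Continuous Y'')
    (hA : ∀ k ∈ K, ∀ q, HasDerivAt (A k) (A' k q) q) (hA' : ∀ k ∈ K, Continuous (A' k))
    (hσ : ∀ k, |σ k| ≤ 1)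
    (hGM : ∀ s ∈ Set.Icc a b, |G s| ≤ M) (hGM' : ∀ s ∈ Set.Icc a b, |G' s| ≤ M)
    (hYM : ∀ k ∈ K, ∀ s ∈ Set.Icc a b, |dot2 (u k) (Y'' s)| ≤ M)
    (hS : ∀ s ∈ Set.Icc a b, ∑ k ∈ K, |A k (dot2 (u k) (Y s))| ≤ S)
    (hu : ∀ k ∈ K, ∀ s ∈ Set.Icc a b, c ≤ |dot2 (u k) (Y' s)|) :
    |∫ s in a..b, if 0 < h s then ∑ k ∈ K, σ k * (G s * A' k (dot2 (u k) (Y s))) else 0| ≤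
      (2 * (n + 1) * (M / c) + (b - a) * (M / c + M * M / c ^ 2)) * S := by
  set D : ι → ℝ → ℝ := fun k s => dot2 (u k) (Y' s)
  set E : ι → ℝ → ℝ := fun k s => dot2 (u k) (Y'' s)
  set q : ι → ℝ → ℝ := fun k s => dot2 (u k) (Y s)
  have hD : ∀ k s, HasDerivAt (D k) (E k s) s := fun k s => hasDerivAt_dot2 _ (hY' s)
  have hq : ∀ k s, HasDerivAt (q k) (D k s) s := fun k s => hasDerivAt_dot2 _ (hY s)
  have hDpos : ∀ k ∈ K, ∀ s ∈ Set.Icc a b, 0 < |D k s| :=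
    fun k hk s hs => hc.trans_le (hu k hk s hs)
  have hDne : ∀ k ∈ K, ∀ s ∈ Set.Icc a b, D k s ≠ 0 := fun k hk s hs => abs_pos.1 (hDpos k hk s hs)
  set P : ι → ℝ → ℝ := fun k s => G s / D k s
  set P' : ι → ℝ → ℝ := fun k s => (G' s * D k s - G s * E k s) / D k s ^ 2
  have hP : ∀ k ∈ K, ∀ s ∈ Set.Icc a b, HasDerivAt (P k) (P' k s) s := fun k hk s hs =>
    (hG s).div (hD k s) (hDne k hk s hs)
  have hPM : ∀ k ∈ K, ∀ s ∈ Set.Icc a b, |P k s| ≤ M / c := fun k hk s hs => by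
    rw [abs_div]
    exact div_le_div₀ hM (hGM s hs) hc (hu k hk s hs)
  have hPM' : ∀ k ∈ K, ∀ s ∈ Set.Icc a b, |P' k s| ≤ M / c + M * M / c ^ 2 := fun k hk s hs => by
    have e : P' k s = G' s / D k s - G s * E k s / D k s ^ 2 := by
      have := hDne k hk s hs
      simp only [P']; field_simp
    rw [e]
    refine (abs_sub _ _).trans (add_le_add ?_ ?_)
    · rw [abs_div]; exact div_le_div₀ hM (hGM' s hs) hc (hu k hk s hs)
    · rw [abs_div, abs_mul, abs_pow]
      exact div_le_div₀ (by positivity) (mul_le_mul (hGM s hs) (hYM k hk s hs) (abs_nonneg _) hM)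
        (by positivity) (pow_le_pow_left₀ hc.le (hu k hk s hs) 2)
  have hS0 : 0 ≤ S := (Finset.sum_nonneg fun _ _ => abs_nonneg _).trans (hS a ⟨le_rfl, hab⟩)
  have hsum : ∀ (W : ι → ℝ → ℝ) (m : ℝ), 0 ≤ m → (∀ k ∈ K, ∀ s ∈ Set.Icc a b, |W k s| ≤ m) →
      ∀ s ∈ Set.Icc a b, |∑ k ∈ K, σ k * (W k s * A k (q k s))| ≤ m * S := by
    intro W m hm hW s hs
    calc _ ≤ ∑ k ∈ K, |σ k * (W k s * A k (q k s))| := Finset.abs_sum_le_sum_abs _ _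
      _ ≤ ∑ k ∈ K, m * |A k (q k s)| := Finset.sum_le_sum fun k hk => by
          rw [abs_mul, abs_mul]
          have := mul_le_mul (hσ k) (mul_le_mul_of_nonneg_right (hW k hk s hs)
            (abs_nonneg (A k (q k s)))) (by positivity) zero_le_one
          rwa [one_mul] at this
      _ ≤ m * S := by
          rw [← Finset.mul_sum]; exact mul_le_mul_of_nonneg_left (hS s hs) hm
  have cG : Continuous G := continuous_iff_continuousAt.2 fun s => (hG s).continuousAt
  have cD : ∀ k, Continuous (D k) := fun k => continuous_iff_continuousAt.2 fun s =>
    (hD k s).continuousAt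
  have cq : ∀ k, Continuous (q k) := fun k => continuous_iff_continuousAt.2 fun s =>
    (hq k s).continuousAt
  have cE : ∀ k, Continuous (E k) := fun k => (continuous_dot2 _).comp hY''
  have cA : ∀ k ∈ K, Continuous (A k) := fun k hk => continuous_iff_continuousAt.2 fun s =>
    (hA k hk s).continuousAt
  have cP : ∀ k ∈ K, ContinuousOn (P k) (Set.Icc a b) := fun k hk =>
    cG.continuousOn.div (cD k).continuousOn (hDne k hk)
  have cP' : ∀ k ∈ K, ContinuousOn (P' k) (Set.Icc a b) := fun k hk =>
    (((hG'.mul (cD k)).sub (cG.mul (cE k))).continuousOn).div ((cD k).pow 2).continuousOn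
      fun s hs => pow_ne_zero 2 (hDne k hk s hs)
  set R : ℝ → ℝ := fun s => ∑ k ∈ K, σ k * (P' k s * A k (q k s))
  set φ : ℝ → ℝ := fun s => ∑ k ∈ K, σ k * (P k s * A k (q k s))
  set φ' : ℝ → ℝ := fun s => ∑ k ∈ K,
    σ k * (P' k s * A k (q k s) + P k s * (A' k (q k s) * D k s))
  have hφ : ∀ s ∈ Set.Icc a b, HasDerivAt φ (φ' s) s := fun s hs =>
    HasDerivAt.fun_sum fun k hk =>
      ((hP k hk s hs).mul ((hA k hk _).comp s (hq k s))).const_mul _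
  have cR : ContinuousOn R (Set.Icc a b) := continuousOn_finsetSum _ fun k hk =>
    continuousOn_const.mul ((cP' k hk).mul ((cA k hk).comp (cq k)).continuousOn)
  have cφ' : ContinuousOn φ' (Set.Icc a b) := continuousOn_finsetSum _ fun k hk =>
    continuousOn_const.mul (((cP' k hk).mul ((cA k hk).comp (cq k)).continuousOn).add
      ((cP k hk).mul ((((hA' k hk).comp (cq k)).mul (cD k)).continuousOn)))
  have hsplit : ∀ s ∈ Set.Icc a b, ∑ k ∈ K, σ k * (G s * A' k (dot2 (u k) (Y s))) =
      φ' s - R s := by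
    intro s hs
    rw [← Finset.sum_sub_distrib]
    refine Finset.sum_congr rfl fun k hk => ?_
    have : P k s * D k s = G s := div_mul_cancel₀ _ (hDne k hk s hs)
    rw [← this]; ring
  have hInt : ∫ s in a..b, (if 0 < h s then ∑ k ∈ K, σ k * (G s * A' k (dot2 (u k) (Y s))) else 0) =
      (∫ s in a..b, if 0 < h s then φ' s else 0) - ∫ s in a..b, if 0 < h s then R s else 0 := by
    rw [← intervalIntegral.integral_sub (intervalIntegrable_ite_pos hab hh cφ')
      (intervalIntegrable_ite_pos hab hh cR)]
    refine intervalIntegral.integral_congr fun s hs => ?_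
    rw [Set.uIcc_of_le hab] at hs
    simp only [hsplit s hs]
    split_ifs <;> simp
  rw [hInt]
  refine (abs_sub _ _).trans ?_
  have b1 := abs_integral_ite_deriv_le hh hab hφ cφ'
    (hsum P (M / c) (by positivity) hPM) hfin hcard
  have b2 := abs_integral_ite_le (h := h) hab
    (hsum P' (M / c + M * M / c ^ 2) (by positivity) hPM')
  calc _ ≤ _ := add_le_add b1 b2
    _ = _ := by ring

/-- Summed slice estimate: every phase is either non-stationary along the curve, or far from the
singularity of its response. -/
lemma abs_integral_ite_slice_le {ι : Type*} (K : Finset ι) {h G G' : ℝ → ℝ}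
    {Y Y' Y'' : ℝ → ℝ × ℝ} {u : ι → ℝ × ℝ} {A A' : ι → ℝ → ℝ} {σ : ι → ℝ}
    {a b c M S T : ℝ} {n : ℕ}
    (hab : a ≤ b) (hc : 0 < c) (hM : 0 ≤ M) (hh : Continuous h)
    (hfin : {s ∈ Set.Ioo a b | h s = 0}.Finite) (hcard : {s ∈ Set.Ioo a b | h s = 0}.ncard = n)
    (hG : ∀ s, HasDerivAt G (G' s) s) (hG' : Continuous G')
    (hY : ∀ s, HasDerivAt Y (Y' s) s) (hY' : ∀ s, HasDerivAt Y' (Y'' s) s) (hY'' : Continuous Y'')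
    (hA : ∀ k ∈ K, ∀ q, HasDerivAt (A k) (A' k q) q) (hA' : ∀ k ∈ K, Continuous (A' k))
    (hσ : ∀ k, |σ k| ≤ 1)
    (hGM : ∀ s ∈ Set.Icc a b, |G s| ≤ M) (hGM' : ∀ s ∈ Set.Icc a b, |G' s| ≤ M)
    (hYM : ∀ k ∈ K, ∀ s ∈ Set.Icc a b, |dot2 (u k) (Y'' s)| ≤ M)
    (hS : ∀ s ∈ Set.Icc a b, ∑ k ∈ K, |A k (dot2 (u k) (Y s))| ≤ S)
    (hT : 0 ≤ T)
    (hu : ∀ k ∈ K, (∀ s ∈ Set.Icc a b, c ≤ |dot2 (u k) (Y' s)|) ∨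
      ∀ s ∈ Set.Icc a b, |A' k (dot2 (u k) (Y s))| ≤ T) :
    |∫ s in a..b, if 0 < h s then ∑ k ∈ K, σ k * (G s * A' k (dot2 (u k) (Y s))) else 0| ≤
      (2 * (n + 1) * (M / c) + (b - a) * (M / c + M * M / c ^ 2)) * S +
        K.card * (M * T) * (b - a) := by
  classical
  set K₁ := K.filter fun k => ∀ s ∈ Set.Icc a b, c ≤ |dot2 (u k) (Y' s)|
  set K₂ := K.filter fun k => ¬ ∀ s ∈ Set.Icc a b, c ≤ |dot2 (u k) (Y' s)|
  have s1 : K₁ ⊆ K := Finset.filter_subset _ _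
  have s2 : K₂ ⊆ K := Finset.filter_subset _ _
  have cG : Continuous G := continuous_iff_continuousAt.2 fun s => (hG s).continuousAt
  have cY : Continuous Y := continuous_iff_continuousAt.2 fun s => (hY s).continuousAt
  have cont : ∀ K' ⊆ K, ContinuousOn
      (fun s => ∑ k ∈ K', σ k * (G s * A' k (dot2 (u k) (Y s)))) (Set.Icc a b) := fun K' hK' =>
    continuousOn_finsetSum _ fun k hk => continuousOn_const.mul (cG.mul
      ((hA' k (hK' hk)).comp ((continuous_dot2 _).comp cY))).continuousOn
  have hInt : ∫ s in a..b, (if 0 < h s then ∑ k ∈ K, σ k * (G s * A' k (dot2 (u k) (Y s))) else 0) =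
      (∫ s in a..b, if 0 < h s then ∑ k ∈ K₁, σ k * (G s * A' k (dot2 (u k) (Y s))) else 0) +
      ∫ s in a..b, if 0 < h s then ∑ k ∈ K₂, σ k * (G s * A' k (dot2 (u k) (Y s))) else 0 := by
    rw [← intervalIntegral.integral_add (intervalIntegrable_ite_pos hab hh (cont K₁ s1))
      (intervalIntegrable_ite_pos hab hh (cont K₂ s2))]
    refine intervalIntegral.integral_congr fun s _ => ?_
    simp only [← Finset.sum_filter_add_sum_filter_not K
      (fun k => ∀ s ∈ Set.Icc a b, c ≤ |dot2 (u k) (Y' s)|)]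
    split_ifs <;> simp [K₁, K₂]
  rw [hInt]
  refine (abs_add_le _ _).trans (add_le_add ?_ ?_)
  · exact abs_integral_ite_transversal_le K₁ hab hc hM hh hfin hcard hG hG' hY hY' hY''
      (fun k hk => hA k (s1 hk)) (fun k hk => hA' k (s1 hk)) hσ hGM hGM'
      (fun k hk => hYM k (s1 hk))
      (fun s hs => (Finset.sum_le_sum_of_subset_of_nonneg s1 fun _ _ _ => abs_nonneg _).trans
        (hS s hs)) fun k hk => (Finset.mem_filter.1 hk).2
  · refine abs_integral_ite_le hab fun s hs => ?_
    calc _ ≤ ∑ k ∈ K₂, |σ k * (G s * A' k (dot2 (u k) (Y s)))| := Finset.abs_sum_le_sum_abs _ _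
      _ ≤ ∑ k ∈ K₂, M * T := Finset.sum_le_sum fun k hk => by
          have h2 := (hu k (s2 hk)).resolve_left (Finset.mem_filter.1 hk).2 s hs
          rw [abs_mul, abs_mul, ← one_mul (M * T)]
          exact mul_le_mul (hσ k) (mul_le_mul (hGM s hs) h2 (abs_nonneg _) hM) (by positivity)
            zero_le_one
      _ = K₂.card * (M * T) := by rw [Finset.sum_const, nsmul_eq_mul]
      _ ≤ K.card * (M * T) := by
          have : (K₂.card : ℝ) ≤ K.card := by exact_mod_cast Finset.card_le_card s2
          gcongr

/-- Tubular coordinates along `y`: signed distance `t = p.1`, parameter `θ = p.2`. -/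
noncomputable def tube (y : ℝ → ℝ × ℝ) (p : ℝ × ℝ) : ℝ × ℝ := y p.2 + p.1 • vec p.2

/-- The velocity of `θ ↦ tube y (t, θ)`. -/
noncomputable def tubeVelocity (y : ℝ → ℝ × ℝ) (p : ℝ × ℝ) : ℝ × ℝ :=
  deriv y p.2 + p.1 • (-Real.sin p.2, Real.cos p.2)

/-- The Jacobian determinant of `tube y`. -/
noncomputable def tubeDet (y : ℝ → ℝ × ℝ) (p : ℝ × ℝ) : ℝ :=
  p.1 + (Real.cos p.2 * (deriv y p.2).2 - Real.sin p.2 * (deriv y p.2).1)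

noncomputable def tubeFDeriv (y : ℝ → ℝ × ℝ) (p : ℝ × ℝ) : ℝ × ℝ →L[ℝ] ℝ × ℝ :=
  (Matrix.toLin (.finTwoProd ℝ) (.finTwoProd ℝ)
    !![Real.cos p.2, (tubeVelocity y p).1; Real.sin p.2,
      (tubeVelocity y p).2]).toContinuousLinearMap

lemma det_tubeFDeriv (y : ℝ → ℝ × ℝ) (p : ℝ × ℝ) : (tubeFDeriv y p).det = tubeDet y p := by
  unfold tubeFDeriv tubeDet tubeVelocity
  simp only [LinearMap.det_toContinuousLinearMap, LinearMap.det_toLin, Matrix.det_fin_two_of,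
    Prod.fst_add, Prod.snd_add, Prod.smul_fst, Prod.smul_snd, smul_eq_mul]
  linear_combination p.1 * Real.cos_sq_add_sin_sq p.2

lemma hasDerivAt_vec (θ : ℝ) : HasDerivAt vec (-Real.sin θ, Real.cos θ) θ :=
  (Real.hasDerivAt_cos θ).prodMk (Real.hasDerivAt_sin θ)

lemma contDiff_vec {n : WithTop ℕ∞} : ContDiff ℝ n vec := Real.contDiff_cos.prodMk Real.contDiff_sin

lemma hasFDerivAt_tube {y : ℝ → ℝ × ℝ} (hy : ContDiff ℝ 4 y) (p : ℝ × ℝ) :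
    HasFDerivAt (tube y) (tubeFDeriv y p) p := by
  have h1 : HasFDerivAt (fun p : ℝ × ℝ => y p.2) _ p :=
    ((hy.differentiable (by norm_num)).differentiableAt.hasDerivAt (x := p.2)).hasFDerivAt.comp p
      (hasFDerivAt_snd (p := p))
  have h2 : HasFDerivAt (fun p : ℝ × ℝ => vec p.2) _ p :=
    (hasDerivAt_vec p.2).hasFDerivAt.comp p (hasFDerivAt_snd (p := p))
  have h3 := h1.add ((hasFDerivAt_fst (p := p)).smul h2)
  refine h3.congr_fderiv ?_
  rw [tubeFDeriv, Matrix.toLin_finTwoProd_toContinuousLinearMap]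
  ext <;> simp [vec, tubeVelocity]

lemma contDiff_tube {y : ℝ → ℝ × ℝ} (hy : ContDiff ℝ 4 y) : ContDiff ℝ 4 (tube y) :=
  (hy.comp contDiff_snd).add (contDiff_fst.smul (contDiff_vec.comp contDiff_snd))

lemma contDiff_deriv_curve {y : ℝ → ℝ × ℝ} (hy : ContDiff ℝ 4 y) : ContDiff ℝ 3 (deriv y) :=
  (contDiff_succ_iff_deriv.1 (hy : ContDiff ℝ (3 + 1) y)).2.2

lemma contDiff_tubeVelocity {y : ℝ → ℝ × ℝ} (hy : ContDiff ℝ 4 y) :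
    ContDiff ℝ 3 (tubeVelocity y) :=
  ((contDiff_deriv_curve hy).comp contDiff_snd).add (contDiff_fst.smul
    ((Real.contDiff_sin.neg.prodMk Real.contDiff_cos).comp contDiff_snd))

lemma contDiff_tubeDet {y : ℝ → ℝ × ℝ} (hy : ContDiff ℝ 4 y) : ContDiff ℝ 3 (tubeDet y) := by
  have h := (contDiff_deriv_curve hy).comp (contDiff_snd (E := ℝ) (F := ℝ))
  exact contDiff_fst.add (((Real.contDiff_cos.comp contDiff_snd).mul (contDiff_snd.comp h)).sub
    ((Real.contDiff_sin.comp contDiff_snd).mul (contDiff_fst.comp h)))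

lemma hasDerivAt_tube {y : ℝ → ℝ × ℝ} (hy : ContDiff ℝ 4 y) (t θ : ℝ) :
    HasDerivAt (fun θ => tube y (t, θ)) (tubeVelocity y (t, θ)) θ :=
  ((hy.differentiable (by norm_num)).differentiableAt.hasDerivAt).add
    ((hasDerivAt_vec θ).const_smul t)

lemma eventually_forall_closedBall {X : Type*} [PseudoMetricSpace X] {P : X → Prop} {z : X}
    (h : ∀ᶠ p in 𝓝 z, P p) : ∀ᶠ r : ℝ in 𝓝[>] 0, ∀ p ∈ Metric.closedBall z r, P p := by
  obtain ⟨s, hs, hP⟩ := Metric.nhds_basis_closedBall.eventually_iff.1 h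
  filter_upwards [Ioo_mem_nhdsGT hs] with r hr p hp
  exact hP (Metric.closedBall_subset_closedBall hr.2.le hp)

lemma eventually_injOn_tube {y : ℝ → ℝ × ℝ} (hy : ContDiff ℝ 4 y) {z : ℝ × ℝ}
    (hz : tubeDet y z ≠ 0) :
    ∀ᶠ r : ℝ in 𝓝[>] 0, Set.InjOn (tube y) (Metric.ball z r) ∧
      IsOpen (tube y '' Metric.ball z r) := by
  have hstrict := (contDiff_tube hy).contDiffAt.hasStrictFDerivAt' (hasFDerivAt_tube hy z)
    (by norm_num)
  have hdet : (tubeFDeriv y z).det ≠ 0 := by rwa [det_tubeFDeriv]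
  have hst : HasStrictFDerivAt (tube y)
      ((tubeFDeriv y z).toContinuousLinearEquivOfDetNeZero hdet : ℝ × ℝ →L[ℝ] ℝ × ℝ) z := hstrict
  set e := hst.toOpenPartialHomeomorph
  have hsrc : e.source ∈ 𝓝 z := e.open_source.mem_nhds hst.mem_toOpenPartialHomeomorph_source
  filter_upwards [eventually_forall_closedBall hsrc] with r hr
  have hsub : Metric.ball z r ⊆ e.source := fun p hp => hr p (Metric.ball_subset_closedBall hp)
  exact ⟨e.injOn.mono hsub, e.isOpen_image_of_subset_source Metric.isOpen_ball hsub⟩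

lemma abs_dot2_le (u v : ℝ × ℝ) (hu : u.1 ^ 2 + u.2 ^ 2 = 1) : |dot2 u v| ≤ 2 * ‖v‖ := by
  have h1 : |u.1| ≤ 1 := abs_le_one_iff_mul_self_le_one.2 (by nlinarith [sq_nonneg u.2])
  have h2 : |u.2| ≤ 1 := abs_le_one_iff_mul_self_le_one.2 (by nlinarith [sq_nonneg u.1])
  have h3 : |v.1| ≤ ‖v‖ := norm_fst_le v
  have h4 : |v.2| ≤ ‖v‖ := norm_snd_le v
  refine (abs_add_le _ _).trans ?_
  rw [abs_mul, abs_mul]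
  nlinarith [abs_nonneg u.1, abs_nonneg u.2, abs_nonneg v.1, abs_nonneg v.2]

lemma dot2_sub (u v w : ℝ × ℝ) : dot2 u (v - w) = dot2 u v - dot2 u w := by
  simp [dot2]; ring

/-- A unit covector cannot annihilate two independent vectors. -/
lemma exists_pos_le_abs_dot2 {m v : ℝ × ℝ} (h : m.1 * v.2 ≠ m.2 * v.1) :
    ∃ c : ℝ, 0 < c ∧ ∀ u : ℝ × ℝ, u.1 ^ 2 + u.2 ^ 2 = 1 →
      2 * c ≤ |dot2 u v| ∨ 2 * c ≤ |dot2 u m| := by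
  set W := |m.1 * v.2 - m.2 * v.1|
  have hW : 0 < W := abs_pos.2 (sub_ne_zero.2 h)
  set D := 4 * (‖v‖ + ‖m‖) + 1
  have hD : 0 < D := by positivity
  refine ⟨W / (2 * D), by positivity, fun u hu => ?_⟩
  by_contra! hcon
  obtain ⟨h1, h2⟩ := hcon
  have e : 2 * (W / (2 * D)) = W / D := by field_simp
  rw [e, lt_div_iff₀ hD] at h1 h2
  have hu' : ((-u.2, u.1) : ℝ × ℝ).1 ^ 2 + ((-u.2, u.1) : ℝ × ℝ).2 ^ 2 = 1 := by
    simp only; linarith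
  have h3 := abs_dot2_le (-u.2, u.1) v hu'
  have h4 := abs_dot2_le (-u.2, u.1) m hu'
  have key : m.1 * v.2 - m.2 * v.1 =
      dot2 u m * dot2 (-u.2, u.1) v - dot2 (-u.2, u.1) m * dot2 u v := by
    simp only [dot2]; linear_combination (-(m.1 * v.2 - m.2 * v.1)) * hu
  have hle : W ≤ |dot2 u m| * (2 * ‖v‖) + (2 * ‖m‖) * |dot2 u v| := by
    simp only [W]
    rw [key]
    refine (abs_sub _ _).trans ?_
    rw [abs_mul, abs_mul]
    gcongr
  have : W * D ≤ W * (2 * ‖v‖) + W * (2 * ‖m‖) := by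
    have i1 := mul_le_mul_of_nonneg_right h2.le (by positivity : 0 ≤ 2 * ‖v‖)
    have i2 := mul_le_mul_of_nonneg_right h1.le (by positivity : 0 ≤ 2 * ‖m‖)
    nlinarith
  have hp : 0 ≤ W * (‖v‖ + ‖m‖) := by positivity
  simp only [D] at this
  nlinarith

/-- A coordinate box around `(0, θ₀)` on which everything needed is uniformly nondegenerate. -/
structure TubeBox (y : ℝ → ℝ × ℝ) (x₀ : ℝ × ℝ) (a Q θ₀ r c d σ : ℝ) : Prop where
  radius_pos : 0 < r
  angle_pos : 0 < c
  dist_pos : 0 < d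
  sign : |σ| = 1
  injOn : Set.InjOn (tube y) (Metric.ball (0, θ₀) r)
  isOpen_image : IsOpen (tube y '' Metric.ball (0, θ₀) r)
  subset : Metric.closedBall θ₀ r ⊆ Set.Icc (-a) a
  abs_det : ∀ p ∈ Metric.closedBall ((0 : ℝ), θ₀) r, |tubeDet y p| = σ * tubeDet y p
  norm_le : ∀ p ∈ Metric.closedBall ((0 : ℝ), θ₀) r, ‖tube y p‖ ≤ Q
  far : ∀ x, dist x x₀ < d → ∀ p ∈ Metric.closedBall ((0 : ℝ), θ₀) r,
    d ≤ Real.sqrt ((x - tube y p).1 ^ 2 + (x - tube y p).2 ^ 2)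
  dichotomy : ∀ u : ℝ × ℝ, u.1 ^ 2 + u.2 ^ 2 = 1 →
    (∀ p ∈ Metric.closedBall ((0 : ℝ), θ₀) r, c ≤ |dot2 u (tubeVelocity y p)|) ∨
    ∀ p ∈ Metric.closedBall ((0 : ℝ), θ₀) r, ∀ x, dist x x₀ < d → c ≤ |dot2 u (x - tube y p)|

lemma norm_le_sqrt (v : ℝ × ℝ) : ‖v‖ ≤ Real.sqrt (v.1 ^ 2 + v.2 ^ 2) := by
  rw [Prod.norm_def]
  exact max_le (Real.abs_le_sqrt (by nlinarith [sq_nonneg v.2]))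
    (Real.abs_le_sqrt (by nlinarith [sq_nonneg v.1]))

lemma exists_tubeBox {y : ℝ → ℝ × ℝ} (hy : ContDiff ℝ 4 y) {x₀ : ℝ × ℝ} {a Q θ₀ : ℝ}
    (hθ₀ : θ₀ ∈ Set.Ioo (-a) a) (hdet : tubeDet y (0, θ₀) ≠ 0) (hQ : ‖y θ₀‖ < Q)
    (hcross : (x₀ - y θ₀).1 * (deriv y θ₀).2 ≠ (x₀ - y θ₀).2 * (deriv y θ₀).1) :
    ∃ r c d σ : ℝ, TubeBox y x₀ a Q θ₀ r c d σ := by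
  obtain ⟨c, hc, hdich⟩ := exists_pos_le_abs_dot2 hcross
  have htube0 : tube y (0, θ₀) = y θ₀ := by simp [tube]
  have hvel0 : tubeVelocity y (0, θ₀) = deriv y θ₀ := by simp [tubeVelocity]
  have hne : 0 < ‖x₀ - y θ₀‖ := norm_pos_iff.2 fun h0 => hcross (by simp [h0])
  have cont := (contDiff_tube hy).continuous
  have cvel := (contDiff_tubeVelocity hy).continuous
  have cdet := (contDiff_tubeDet hy).continuous
  set d := min (c / 4) (‖x₀ - y θ₀‖ / 3)
  have hd : 0 < d := lt_min (by positivity) (by positivity)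
  obtain ⟨σ, hσ, hσpos⟩ : ∃ σ : ℝ, |σ| = 1 ∧ 0 < σ * tubeDet y (0, θ₀) := by
    rcases lt_or_gt_of_ne hdet with h | h
    · exact ⟨-1, by simp, by linarith⟩
    · exact ⟨1, by simp, by linarith⟩
  have ev1 : ∀ᶠ p in 𝓝 ((0 : ℝ), θ₀), dist (tube y p) (y θ₀) < d := by
    have := cont.continuousAt (x := ((0 : ℝ), θ₀)) (Metric.ball_mem_nhds _ hd)
    rw [htube0] at this; exact this
  have ev2 : ∀ᶠ p in 𝓝 ((0 : ℝ), θ₀), dist (tubeVelocity y p) (deriv y θ₀) < d := by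
    have := cvel.continuousAt (x := ((0 : ℝ), θ₀)) (Metric.ball_mem_nhds _ hd)
    rw [hvel0] at this; exact this
  have ev3 : ∀ᶠ p in 𝓝 ((0 : ℝ), θ₀), 0 < σ * tubeDet y p :=
    (continuous_const.mul cdet).continuousAt.eventually_const_lt hσpos
  have ev4 : ∀ᶠ p in 𝓝 ((0 : ℝ), θ₀), ‖tube y p‖ < Q :=
    cont.norm.continuousAt.eventually_lt_const (by simpa only [htube0] using hQ)
  have ev5 : ∀ᶠ θ in 𝓝 θ₀, θ ∈ Set.Icc (-a) a := Icc_mem_nhds hθ₀.1 hθ₀.2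
  obtain ⟨r, ⟨⟨hinj, hopen⟩, h1, h2, h3, h4, h5⟩, hr⟩ :=
    ((eventually_injOn_tube hy hdet).and <| (eventually_forall_closedBall ev1).and <|
      (eventually_forall_closedBall ev2).and <| (eventually_forall_closedBall ev3).and <|
      (eventually_forall_closedBall ev4).and <| (eventually_forall_closedBall ev5)).and
      self_mem_nhdsWithin |>.exists
  refine ⟨r, c, d, σ, hr, hc, hd, hσ, hinj, hopen, h5, fun p hp => ?_, fun p hp => (h4 p hp).le,
    fun x hx p hp => ?_, fun u hu => ?_⟩
  · rw [← abs_of_pos (h3 p hp), abs_mul, hσ, one_mul]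
  · refine le_trans ?_ (norm_le_sqrt _)
    have i1 := h1 p hp
    rw [dist_eq_norm] at hx i1
    have e : x₀ - y θ₀ = (x - tube y p) + (tube y p - y θ₀) - (x - x₀) := by abel
    have i2 : ‖x₀ - y θ₀‖ ≤ ‖x - tube y p‖ + ‖tube y p - y θ₀‖ + ‖x - x₀‖ := by
      rw [e]
      exact (norm_sub_le _ _).trans (by gcongr; exact norm_add_le _ _)
    have i3 : d ≤ ‖x₀ - y θ₀‖ / 3 := min_le_right _ _
    linarith
  · have i3 : d ≤ c / 4 := min_le_left _ _
    refine (hdich u hu).imp (fun hv p hp => ?_) fun hm p hp x hx => ?_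
    · have i1 := h2 p hp
      rw [dist_eq_norm] at i1
      have i2 := abs_dot2_le u (tubeVelocity y p - deriv y θ₀) hu
      rw [dot2_sub] at i2
      have i4 := abs_sub_abs_le_abs_sub (dot2 u (deriv y θ₀)) (dot2 u (tubeVelocity y p))
      rw [abs_sub_comm] at i4
      linarith
    · have i1 := h1 p hp
      rw [dist_eq_norm] at hx i1
      have i2 := abs_dot2_le u ((x - tube y p) - (x₀ - y θ₀)) hu
      have e : (x - tube y p) - (x₀ - y θ₀) = (x - x₀) - (tube y p - y θ₀) := by abel
      have i5 : ‖(x - tube y p) - (x₀ - y θ₀)‖ ≤ ‖x - x₀‖ + ‖tube y p - y θ₀‖ := by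
        rw [e]; exact norm_sub_le _ _
      rw [dot2_sub] at i2
      have i4 := abs_sub_abs_le_abs_sub (dot2 u (x₀ - y θ₀)) (dot2 u (x - tube y p))
      rw [abs_sub_comm] at i4
      linarith

/-- Sign of the jump at tubular coordinates `p` when the boundary is displaced by `h`. -/
noncomputable def jumpSign (h : ℝ → ℝ) (p : ℝ × ℝ) : ℝ :=
  if 0 < p.1 ∧ p.1 < h p.2 then 1 else if h p.2 < p.1 ∧ p.1 < 0 then -1 else 0

lemma measurable_jumpSign {h : ℝ → ℝ} (hh : Continuous h) : Measurable (jumpSign h) := by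
  have h1 : Continuous fun p : ℝ × ℝ => h p.2 := hh.comp continuous_snd
  refine Measurable.ite ?_ measurable_const (Measurable.ite ?_ measurable_const measurable_const)
  · exact ((isOpen_lt continuous_const continuous_fst).inter
      (isOpen_lt continuous_fst h1)).measurableSet
  · exact ((isOpen_lt h1 continuous_fst).inter
      (isOpen_lt continuous_fst continuous_const)).measurableSet

lemma abs_jumpSign_le (h : ℝ → ℝ) (p : ℝ × ℝ) : |jumpSign h p| ≤ 1 := by
  unfold jumpSign; split_ifs <;> simp

lemma jumpSign_eq_zero {h : ℝ → ℝ} {p : ℝ × ℝ} (hp : |h p.2| < |p.1|) : jumpSign h p = 0 := by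
  unfold jumpSign
  rw [if_neg, if_neg]
  · rintro ⟨h1, h2⟩
    rw [abs_of_neg h2] at hp
    linarith [neg_abs_le (h p.2)]
  · rintro ⟨h1, h2⟩
    rw [abs_of_pos h1] at hp
    linarith [le_abs_self (h p.2)]

lemma jumpSign_of_pos {h : ℝ → ℝ} {t : ℝ} (ht : 0 < t) (θ : ℝ) :
    jumpSign h (t, θ) = if 0 < h θ - t then 1 else 0 := by
  simp only [jumpSign, ht, true_and, sub_pos]
  split_ifs with h1 h2
  · rfl
  · linarith [h2.2]
  · rfl

lemma jumpSign_of_neg {h : ℝ → ℝ} {t : ℝ} (ht : t < 0) (θ : ℝ) :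
    jumpSign h (t, θ) = -(if 0 < t - h θ then 1 else 0) := by
  simp only [jumpSign, ht, and_true, sub_pos]
  rw [if_neg (fun h1 => lt_asymm ht h1.1)]
  split_ifs <;> simp

lemma jumpSign_zero (h : ℝ → ℝ) (θ : ℝ) : jumpSign h (0, θ) = 0 := by
  simp [jumpSign]

section ChangeOfVariables

variable {y : ℝ → ℝ × ℝ} {x₀ : ℝ × ℝ} {a Q θ₀ r c d σ : ℝ} {df g F : ℝ × ℝ → ℝ} {h : ℝ → ℝ}

lemma ball_eq_prod (θ₀ r : ℝ) :
    Metric.ball ((0 : ℝ), θ₀) r = Set.Ioo (-r) r ×ˢ Set.Ioo (θ₀ - r) (θ₀ + r) := by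
  rw [← ball_prod_same, Real.ball_eq_Ioo, Real.ball_eq_Ioo, zero_sub, zero_add]

lemma closedBall_eq_prod (θ₀ r : ℝ) :
    Metric.closedBall ((0 : ℝ), θ₀) r = Set.Icc (-r) r ×ˢ Set.Icc (θ₀ - r) (θ₀ + r) := by
  rw [← closedBall_prod_same, Real.closedBall_eq_Icc, Real.closedBall_eq_Icc, zero_sub, zero_add]

lemma TubeBox.integrableOn (hy : ContDiff ℝ 4 y) (hdf : Continuous df) (hF : Continuous F)
    (hh : Continuous h) :
    IntegrableOn (fun p => σ * tubeDet y p * (F (tube y p) * df (tube y p)) * jumpSign h p)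
      (Metric.ball ((0 : ℝ), θ₀) r) := by
  have cont := (contDiff_tube hy).continuous
  have cdet := (contDiff_tubeDet hy).continuous
  have h1 : IntegrableOn (fun p => σ * tubeDet y p * (F (tube y p) * df (tube y p)))
      (Metric.ball ((0 : ℝ), θ₀) r) :=
    ((by fun_prop : Continuous fun p => σ * tubeDet y p *
      (F (tube y p) * df (tube y p))).continuousOn.integrableOn_compact
        (isCompact_closedBall _ _)).mono_set Metric.ball_subset_closedBall
  exact h1.mul_bdd (c := 1) (measurable_jumpSign hh).aestronglyMeasurable
    (ae_of_all _ fun p => abs_jumpSign_le h p)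

lemma TubeBox.integrand_eq (D : TubeBox y x₀ a Q θ₀ r c d σ)
    (hg : ∀ θ ∈ Set.Icc (-a) a, ∀ t, g (tube y (t, θ)) = jumpSign h (t, θ) * df (tube y (t, θ)))
    {p : ℝ × ℝ} (hp : p ∈ Metric.ball ((0 : ℝ), θ₀) r) :
    |(tubeFDeriv y p).det| • (F (tube y p) * g (tube y p)) =
      σ * tubeDet y p * (F (tube y p) * df (tube y p)) * jumpSign h p := by
  have hp' := Metric.ball_subset_closedBall hp
  have hθ : p.2 ∈ Set.Icc (-a) a := D.subset (by
    rw [← closedBall_prod_same] at hp'; exact hp'.2)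
  rw [det_tubeFDeriv, D.abs_det p hp', smul_eq_mul,
    show g (tube y p) = jumpSign h p * df (tube y p) from hg p.2 hθ p.1]
  ring

lemma TubeBox.integrable (D : TubeBox y x₀ a Q θ₀ r c d σ) (hy : ContDiff ℝ 4 y)
    (hdf : Continuous df) (hF : Continuous F) (hh : Continuous h)
    (hFs : Function.support F ⊆ tube y '' Metric.ball (0, θ₀) r)
    (hg : ∀ θ ∈ Set.Icc (-a) a, ∀ t, g (tube y (t, θ)) = jumpSign h (t, θ) * df (tube y (t, θ))) :
    Integrable fun z => F z * g z := by
  have h1 : IntegrableOn (fun z => F z * g z) (tube y '' Metric.ball (0, θ₀) r) := by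
    rw [integrableOn_image_iff_integrableOn_abs_det_fderiv_smul volume
      Metric.isOpen_ball.measurableSet (fun p _ => (hasFDerivAt_tube hy p).hasFDerivWithinAt)
      D.injOn]
    exact (TubeBox.integrableOn (σ := σ) hy hdf hF hh).congr_fun
      (fun p hp => (D.integrand_eq hg hp).symm) Metric.isOpen_ball.measurableSet
  exact (integrableOn_iff_integrable_of_support_subset fun z hz => hFs fun h0 => hz (by
    simp only [h0, zero_mul])).1 h1

lemma TubeBox.integral_eq (D : TubeBox y x₀ a Q θ₀ r c d σ) (hy : ContDiff ℝ 4 y)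
    (hdf : Continuous df) (hF : Continuous F) (hh : Continuous h)
    (hFs : Function.support F ⊆ tube y '' Metric.ball (0, θ₀) r)
    (hg : ∀ θ ∈ Set.Icc (-a) a, ∀ t, g (tube y (t, θ)) = jumpSign h (t, θ) * df (tube y (t, θ))) :
    ∫ z, F z * g z = ∫ t in Set.Ioo (-r) r, ∫ θ in (θ₀ - r)..(θ₀ + r),
      σ * tubeDet y (t, θ) * (F (tube y (t, θ)) * df (tube y (t, θ))) * jumpSign h (t, θ) := by
  have hr := D.radius_pos
  rw [← setIntegral_eq_integral_of_forall_compl_eq_zero (s := tube y '' Metric.ball (0, θ₀) r)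
    fun z hz => by
      have : F z = 0 := by by_contra h0; exact hz (hFs h0)
      rw [this, zero_mul]]
  rw [integral_image_eq_integral_abs_det_fderiv_smul volume
      Metric.isOpen_ball.measurableSet (fun p _ => (hasFDerivAt_tube hy p).hasFDerivWithinAt)
      D.injOn, setIntegral_congr_fun Metric.isOpen_ball.measurableSet
      (fun p hp => D.integrand_eq hg hp)]
  have hInt := TubeBox.integrableOn (r := r) (θ₀ := θ₀) (σ := σ) hy hdf hF hh
  rw [ball_eq_prod] at hInt ⊢
  rw [Measure.volume_eq_prod] at hInt ⊢
  rw [setIntegral_prod _ hInt]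
  refine setIntegral_congr_fun measurableSet_Ioo fun t _ => ?_
  rw [intervalIntegral.integral_of_le (by linarith), integral_Ioc_eq_integral_Ioo]

end ChangeOfVariables

lemma hasDerivAt_slice {E : Type*} [NormedAddCommGroup E] [NormedSpace ℝ E] {f : ℝ × ℝ → E}
    (hf : ContDiff ℝ 1 f) (t θ : ℝ) :
    HasDerivAt (fun θ => f (t, θ)) (fderiv ℝ f (t, θ) (0, 1)) θ :=
  ((hf.differentiable one_ne_zero).differentiableAt.hasFDerivAt (x := (t, θ))).comp_hasDerivAt θ
    ((hasDerivAt_const θ t).prodMk (hasDerivAt_id θ))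

lemma continuous_fderiv_slice {E : Type*} [NormedAddCommGroup E] [NormedSpace ℝ E] {f : ℝ × ℝ → E}
    (hf : ContDiff ℝ 1 f) : Continuous fun p => fderiv ℝ f p (0, 1) :=
  (hf.continuous_fderiv one_ne_zero).clm_apply continuous_const

/-- Responses to the point `x` at the scanning directions indexed by `K`: bounded by the inverse
distance, with derivatives bounded by the inverse square at a distance. -/
structure ResponseFamily (κ ε C Q : ℝ) (x : ℝ × ℝ) (K : Finset ℤ) (A A' : ℤ → ℝ → ℝ) : Prop where
  angle : ∀ k ∈ K, |(k : ℝ) * (κ * ε)| ≤ Real.pi / 2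
  hasDerivAt : ∀ k ∈ K, ∀ q, HasDerivAt (A k) (A' k q) q
  cont : ∀ k ∈ K, Continuous (A' k)
  near : ∀ k ∈ K, ∀ q, |q| ≤ 2 * Q →
    |A k q| ≤ C / (ε + |dot2 (vec ((k : ℝ) * (κ * ε))) x - q|)
  far : ∀ k ∈ K, ∀ q, C * ε ≤ |dot2 (vec ((k : ℝ) * (κ * ε))) x - q| →
    |A' k q| ≤ C / |dot2 (vec ((k : ℝ) * (κ * ε))) x - q| ^ 2

lemma vec_unit (α : ℝ) : (vec α).1 ^ 2 + (vec α).2 ^ 2 = 1 := Real.cos_sq_add_sin_sq α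

lemma TubeBox.abs_slice_le {y : ℝ → ℝ × ℝ} {x₀ x : ℝ × ℝ} {a Q θ₀ r c d σ κ ε C M S N t : ℝ}
    {h : ℝ → ℝ} {Γ : ℝ × ℝ → ℝ} {K : Finset ℤ} {A A' : ℤ → ℝ → ℝ} {τ : ℤ → ℝ}
    (D : TubeBox y x₀ a Q θ₀ r c d σ) (hy : ContDiff ℝ 4 y) (hh : Continuous h)
    (hΓ : ContDiff ℝ 1 Γ) (R : ResponseFamily κ ε C Q x K A A')
    (hM : 0 ≤ M) (hC : 0 < C) (hεc : C * ε ≤ c) (hx : dist x x₀ < d)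
    (hΓM : ∀ p ∈ Metric.closedBall ((0 : ℝ), θ₀) r, |Γ p| ≤ M)
    (hΓM' : ∀ p ∈ Metric.closedBall ((0 : ℝ), θ₀) r, |fderiv ℝ Γ p (0, 1)| ≤ M)
    (hYM : ∀ p ∈ Metric.closedBall ((0 : ℝ), θ₀) r, 2 * ‖fderiv ℝ (tubeVelocity y) p (0, 1)‖ ≤ M)
    (hτ : ∀ k, |τ k| ≤ 1)
    (hS : ∀ p ∈ Metric.closedBall ((0 : ℝ), θ₀) r,
      ∑ k ∈ K, C / (ε + |dot2 (vec ((k : ℝ) * (κ * ε))) (x - tube y p)|) ≤ S)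
    (ht : t ∈ Set.Icc (-r) r)
    (hfin : {s ∈ Set.Ioo (θ₀ - r) (θ₀ + r) | h s = t}.Finite)
    (hcard : ({s ∈ Set.Ioo (θ₀ - r) (θ₀ + r) | h s = t}.ncard : ℝ) ≤ N) :
    |∫ θ in (θ₀ - r)..(θ₀ + r),
      (∑ k ∈ K, τ k * (Γ (t, θ) * A' k (dot2 (vec ((k : ℝ) * (κ * ε))) (tube y (t, θ))))) *
        jumpSign h (t, θ)| ≤
      (2 * (N + 1) * (M / c) + 2 * r * (M / c + M * M / c ^ 2)) * S +
        K.card * (M * (C / c ^ 2)) * (2 * r) := by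
  have hr := D.radius_pos
  have hc := D.angle_pos
  have hmem : ∀ s ∈ Set.Icc (θ₀ - r) (θ₀ + r), (t, s) ∈ Metric.closedBall ((0 : ℝ), θ₀) r :=
    fun s hs => by rw [closedBall_eq_prod]; exact ⟨ht, hs⟩
  have hS0 : 0 ≤ S := (Finset.sum_nonneg fun k hk =>
    (abs_nonneg _).trans (R.near k hk (dot2 (vec ((k : ℝ) * (κ * ε))) (tube y (0, θ₀))) (by
      refine (abs_dot2_le _ _ (vec_unit _)).trans ?_
      have := D.norm_le (0, θ₀) (Metric.mem_closedBall_self hr.le)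
      linarith)) |>.trans (by rw [dot2_sub])).trans (hS (0, θ₀) (Metric.mem_closedBall_self hr.le))
  have hN : 0 ≤ N := (Nat.cast_nonneg _).trans hcard
  have hvel := (contDiff_tubeVelocity hy).of_le (by norm_num : (1 : WithTop ℕ∞) ≤ 3)
  have main : ∀ h' : ℝ → ℝ, Continuous h' →
      {s ∈ Set.Ioo (θ₀ - r) (θ₀ + r) | h' s = 0} = {s ∈ Set.Ioo (θ₀ - r) (θ₀ + r) | h s = t} →
      |∫ θ in (θ₀ - r)..(θ₀ + r), if 0 < h' θ then
        ∑ k ∈ K, τ k * (Γ (t, θ) * A' k (dot2 (vec ((k : ℝ) * (κ * ε))) (tube y (t, θ)))) else 0| ≤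
      (2 * (N + 1) * (M / c) + 2 * r * (M / c + M * M / c ^ 2)) * S +
        K.card * (M * (C / c ^ 2)) * (2 * r) := by
    intro h' hh' hset
    refine (abs_integral_ite_slice_le (T := C / c ^ 2) (c := c) (M := M) (S := S) (A := A)
      K (by linarith) hc hM hh'
      (hset ▸ hfin) rfl (fun s => hasDerivAt_slice hΓ t s)
      ((continuous_fderiv_slice hΓ).comp (by fun_prop : Continuous fun s : ℝ => (t, s)))
      (hasDerivAt_tube hy t) (fun s => hasDerivAt_slice hvel t s)
      ((continuous_fderiv_slice hvel).comp (by fun_prop : Continuous fun s : ℝ => (t, s)))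
      R.hasDerivAt R.cont hτ (fun s hs => hΓM _ (hmem s hs)) (fun s hs => hΓM' _ (hmem s hs))
      (fun k _ s hs => (abs_dot2_le _ _ (vec_unit _)).trans (hYM _ (hmem s hs)))
      (fun s hs => ?_) (by positivity) fun k hk => ?_).trans ?_
    · refine (Finset.sum_le_sum fun k hk => ?_).trans (hS _ (hmem s hs))
      rw [dot2_sub]
      refine R.near k hk _ ((abs_dot2_le _ _ (vec_unit _)).trans ?_)
      have := D.norm_le _ (hmem s hs)
      linarith
    · refine (D.dichotomy _ (vec_unit ((k : ℝ) * (κ * ε)))).imp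
        (fun hv s hs => hv _ (hmem s hs)) fun hf s hs => ?_
      have hle := hf _ (hmem s hs) x hx
      rw [dot2_sub] at hle
      refine (R.far k hk _ (hεc.trans hle)).trans ?_
      gcongr
    · rw [hset]
      have : θ₀ + r - (θ₀ - r) = 2 * r := by ring
      rw [this]
      gcongr
  rcases lt_trichotomy t 0 with hneg | rfl | hpos
  · have := main (fun s => t - h s) (by fun_prop) (by
      ext s; simp only [Set.mem_ofPred_eq, sub_eq_zero, eq_comm])
    rw [← abs_neg, ← intervalIntegral.integral_neg]
    refine le_of_eq_of_le ?_ this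
    congr 1
    refine intervalIntegral.integral_congr fun s _ => ?_
    simp only [jumpSign_of_neg hneg]
    split_ifs <;> simp
  · simp only [jumpSign_zero, mul_zero, intervalIntegral.integral_zero, abs_zero]
    positivity
  · have := main (fun s => h s - t) (by fun_prop) (by
      ext s; simp only [Set.mem_ofPred_eq, sub_eq_zero])
    refine le_of_eq_of_le ?_ this
    congr 1
    refine intervalIntegral.integral_congr fun s _ => ?_
    simp only [jumpSign_of_pos hpos]
    split_ifs <;> simp

/-- Rescaled form of the level set hypothesis. -/
lemma ncard_level_le {H : ℝ → ℝ} {ε ρ L₀ : ℝ} (hε : 0 < ε)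
    (hlevel : ∀ th b L : ℝ, L₀ ≤ L →
      {s : ℝ | s ∈ Set.Ioo b (b + L) ∧ ε⁻¹ * H (Real.sqrt ε * s) = th}.Finite ∧
      (({s : ℝ | s ∈ Set.Ioo b (b + L) ∧ ε⁻¹ * H (Real.sqrt ε * s) = th}.ncard : ℝ)) ≤ ρ * L)
    {b₁ b₂ t : ℝ} (hb : L₀ * Real.sqrt ε ≤ b₂ - b₁) :
    {s ∈ Set.Ioo b₁ b₂ | H s = t}.Finite ∧
      ({s ∈ Set.Ioo b₁ b₂ | H s = t}.ncard : ℝ) ≤ ρ * ((b₂ - b₁) / Real.sqrt ε) := by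
  have hs := Real.sqrt_pos.2 hε
  obtain ⟨hf, hn⟩ := hlevel (ε⁻¹ * t) (b₁ / Real.sqrt ε) ((b₂ - b₁) / Real.sqrt ε)
    ((le_div_iff₀ hs).2 hb)
  set Z := {s : ℝ | s ∈ Set.Ioo (b₁ / Real.sqrt ε)
    (b₁ / Real.sqrt ε + (b₂ - b₁) / Real.sqrt ε) ∧ ε⁻¹ * H (Real.sqrt ε * s) = ε⁻¹ * t}
  have hsub : {s ∈ Set.Ioo b₁ b₂ | H s = t} ⊆ (fun s => Real.sqrt ε * s) '' Z := by
    rintro s ⟨⟨h1, h2⟩, h3⟩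
    have e : Real.sqrt ε * (s / Real.sqrt ε) = s := mul_div_cancel₀ _ hs.ne'
    refine ⟨s / Real.sqrt ε, ⟨⟨by gcongr, ?_⟩, by rw [e, h3]⟩, e⟩
    rw [← add_div]; gcongr; linarith
  refine ⟨(hf.image _).subset hsub, le_trans ?_ hn⟩
  exact_mod_cast (Set.ncard_le_ncard hsub (hf.image _)).trans (Set.ncard_image_le hf)

/-- The pieces of the perturbation cut out by amplitudes supported in `U` contribute
`O(ε^{-1/2} log (1/ε))` to any family of responses. -/
def LocallyControlled (κ Q ε₀ : ℝ) (x₀ : ℝ × ℝ) (f : ℝ → ℝ × ℝ → ℝ) (U : Set (ℝ × ℝ)) : Prop :=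
  ∀ ψ : ℝ × ℝ → ℝ, ContDiff ℝ 1 ψ → Function.support ψ ⊆ U →
    (∀ ε ∈ Set.Ioo 0 ε₀, ∀ F : ℝ × ℝ → ℝ, Continuous F →
      Integrable fun z => F z * (ψ z * f ε z)) ∧
    ∀ B : ℝ, 0 < B → ∃ C δ ε₁ : ℝ, 0 < C ∧ 0 < δ ∧ 0 < ε₁ ∧ ∀ ε ∈ Set.Ioo 0 ε₀, ε < ε₁ →
      ∀ x, dist x x₀ < δ → ∀ (K : Finset ℤ) (A A' : ℤ → ℝ → ℝ),
      ResponseFamily κ ε B Q x K A A' → ∀ τ : ℤ → ℝ, (∀ k, |τ k| ≤ 1) →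
      |∫ z, (∑ k ∈ K, τ k * A' k (dot2 (vec ((k : ℝ) * (κ * ε))) z)) * (ψ z * f ε z)| ≤
        C * (Real.log (1 / ε) / Real.sqrt ε)

lemma card_le_log {κ : ℝ} (hκ : 0 < κ) : ∃ C : ℝ, 0 < C ∧ ∀ ε : ℝ, 0 < ε → ε < Real.exp (-1) →
    ∀ K : Finset ℤ, (∀ k ∈ K, |(k : ℝ) * (κ * ε)| ≤ Real.pi / 2) →
      (K.card : ℝ) ≤ C * (ε⁻¹ * Real.log (1 / ε)) := by
  obtain ⟨C, hC, h⟩ := sum_one_div_add_abs_dot2_le hκ one_pos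
  refine ⟨3 * C, by positivity, fun ε hε hε1 K hK => ?_⟩
  have h1 := h ε hε hε1 (1, 0) (by norm_num) K hK
  have hlt : ε < 1 := hε1.trans (by rw [← Real.exp_zero]; exact Real.exp_lt_exp.2 (by norm_num))
  have h2 : ∑ k ∈ K, (1 / 3 : ℝ) ≤
      ∑ k ∈ K, 1 / (ε + |dot2 (vec ((k : ℝ) * (κ * ε))) ((1, 0) : ℝ × ℝ)|) := by
    refine Finset.sum_le_sum fun k _ => ?_
    have h3 := abs_dot2_le _ ((1, 0) : ℝ × ℝ) (vec_unit ((k : ℝ) * (κ * ε)))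
    have h4 : ‖((1, 0) : ℝ × ℝ)‖ = 1 := by simp [Prod.norm_def]
    rw [h4] at h3
    exact one_div_le_one_div_of_le (by positivity) (by linarith)
  rw [Finset.sum_const, nsmul_eq_mul] at h2
  linarith

lemma TubeBox.locallyControlled {y : ℝ → ℝ × ℝ} {x₀ : ℝ × ℝ} {a Q θ₀ r c d σ κ c₀ ε₀ ρ L₀ : ℝ}
    (D : TubeBox y x₀ a Q θ₀ r c d σ) (hy : ContDiff ℝ 4 y) (hκ : 0 < κ) (hc₀ : 0 < c₀)
    {H : ℝ → ℝ → ℝ} {df : ℝ × ℝ → ℝ} {f : ℝ → ℝ × ℝ → ℝ} (hdf : ContDiff ℝ 1 df)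
    (hρ : 0 < ρ) (hL₀ : 0 < L₀)
    (hHc : ∀ ε ∈ Set.Ioo (0 : ℝ) ε₀, Continuous (H ε))
    (hH : ∀ ε ∈ Set.Ioo (0 : ℝ) ε₀, ∀ s, |H ε s| ≤ c₀ * ε)
    (hf : ∀ ε ∈ Set.Ioo (0 : ℝ) ε₀, ∀ θ ∈ Set.Icc (-a) a, ∀ t,
      f ε (tube y (t, θ)) = jumpSign (H ε) (t, θ) * df (tube y (t, θ)))
    (hlevel : ∀ ε ∈ Set.Ioo (0:ℝ) ε₀, ∀ th b L : ℝ, L₀ ≤ L →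
      {s : ℝ | s ∈ Set.Ioo b (b + L) ∧ ε⁻¹ * H ε (Real.sqrt ε * s) = th}.Finite ∧
      (({s : ℝ | s ∈ Set.Ioo b (b + L) ∧ ε⁻¹ * H ε (Real.sqrt ε * s) = th}.ncard : ℝ)) ≤ ρ * L) :
    LocallyControlled κ Q ε₀ x₀ f (tube y '' Metric.ball (0, θ₀) r) := by
  intro ψ hψ hψs
  have hr := D.radius_pos
  have hc := D.angle_pos
  have hsupp : ∀ F : ℝ × ℝ → ℝ,
      Function.support (fun z => F z * ψ z) ⊆ tube y '' Metric.ball (0, θ₀) r := fun F z hz =>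
    hψs fun h0 => hz (by simp only [h0, mul_zero])
  refine ⟨fun ε hε F hF => ?_, fun B hB => ?_⟩
  · simp only [← mul_assoc]
    exact D.integrable hy hdf.continuous (hF.mul hψ.continuous) (hHc ε hε) (hsupp F) (hf ε hε)
  have ht1 : ContDiff ℝ 1 (tube y) := (contDiff_tube hy).of_le (by norm_num)
  have hd1 : ContDiff ℝ 1 (tubeDet y) := (contDiff_tubeDet hy).of_le (by norm_num)
  have hv1 : ContDiff ℝ 1 (tubeVelocity y) := (contDiff_tubeVelocity hy).of_le (by norm_num)
  set Γ : ℝ × ℝ → ℝ := fun p => σ * tubeDet y p * (ψ (tube y p) * df (tube y p))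
  have hΓ : ContDiff ℝ 1 Γ := (contDiff_const.mul hd1).mul ((hψ.comp ht1).mul (hdf.comp ht1))
  have hcpt := isCompact_closedBall ((0 : ℝ), θ₀) r
  obtain ⟨M₁, hM₁⟩ := hcpt.exists_bound_of_continuousOn hΓ.continuous.continuousOn
  obtain ⟨M₂, hM₂⟩ := hcpt.exists_bound_of_continuousOn (continuous_fderiv_slice hΓ).continuousOn
  obtain ⟨M₃, hM₃⟩ := hcpt.exists_bound_of_continuousOn (continuous_fderiv_slice hv1).continuousOn
  set M := max (max M₁ M₂) (max (2 * M₃) 0)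
  have hM : 0 ≤ M := (le_max_right _ _).trans (le_max_right _ _)
  obtain ⟨C₁, hC₁, hsum⟩ := sum_one_div_add_abs_dot2_le hκ D.dist_pos
  obtain ⟨C₂, hC₂, hcard⟩ := card_le_log hκ
  set b₁ := (2 * (2 * r * ρ + 1) * (M / c) + 2 * r * (M / c + M * M / c ^ 2)) * (B * C₁)
  set b₂ := C₂ * (M * (B / c ^ 2)) * (2 * r)
  have hb₁ : 0 ≤ b₁ := by positivity
  have hb₂ : 0 ≤ b₂ := by positivity
  refine ⟨(b₁ + b₂) * (2 * c₀) + 1, d,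
    min (min (Real.exp (-1)) (c / B)) (min (r / c₀) ((2 * r / L₀) ^ 2)), by positivity, D.dist_pos,
    by positivity, fun ε hε hε1 x hx K A A' R τ hτ => ?_⟩
  have hε0 := hε.1
  have he1 : ε < Real.exp (-1) := hε1.trans_le ((min_le_left _ _).trans (min_le_left _ _))
  have he2 : ε < c / B := hε1.trans_le ((min_le_left _ _).trans (min_le_right _ _))
  have he3 : ε < r / c₀ := hε1.trans_le ((min_le_right _ _).trans (min_le_left _ _))
  have he4 : ε < (2 * r / L₀) ^ 2 := hε1.trans_le ((min_le_right _ _).trans (min_le_right _ _))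
  rw [lt_div_iff₀ hB] at he2
  rw [lt_div_iff₀ hc₀] at he3
  have hs := Real.sqrt_pos.2 hε0
  have hlt : ε < 1 := he1.trans (by rw [← Real.exp_zero]; exact Real.exp_lt_exp.2 (by norm_num))
  have hlog : 0 ≤ Real.log (1 / ε) := Real.log_nonneg (by rw [le_div_iff₀ hε0]; linarith)
  have hw : 1 ≤ 1 / Real.sqrt ε := by
    rw [le_div_iff₀ hs, one_mul]; exact Real.sqrt_le_one.2 hlt.le
  have hL : L₀ * Real.sqrt ε ≤ θ₀ + r - (θ₀ - r) := by
    have := (Real.sqrt_lt' (by positivity)).2 he4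
    rw [lt_div_iff₀ hL₀] at this
    linarith
  set ℓ := ε⁻¹ * Real.log (1 / ε)
  have hℓ : 0 ≤ ℓ := by positivity
  have hS : ∀ p ∈ Metric.closedBall ((0 : ℝ), θ₀) r,
      ∑ k ∈ K, B / (ε + |dot2 (vec ((k : ℝ) * (κ * ε))) (x - tube y p)|) ≤ B * (C₁ * ℓ) := by
    intro p hp
    have := mul_le_mul_of_nonneg_left (hsum ε hε0 he1 _ (D.far x hx p hp) K R.angle) hB.le
    rw [Finset.mul_sum] at this
    simpa only [mul_one_div] using this
  have hslice : ∀ t ∈ Set.Icc (-(c₀ * ε)) (c₀ * ε),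
      ‖∫ θ in (θ₀ - r)..(θ₀ + r), (∑ k ∈ K, τ k * (Γ (t, θ) *
        A' k (dot2 (vec ((k : ℝ) * (κ * ε))) (tube y (t, θ))))) * jumpSign (H ε) (t, θ)‖ ≤
      (b₁ + b₂) * (ℓ * (1 / Real.sqrt ε)) := by
    intro t ht
    obtain ⟨hfin, hn⟩ := ncard_level_le hε0 (hlevel ε hε) (t := t) hL
    refine (D.abs_slice_le hy (hHc ε hε) hΓ R hM hB (by linarith) hx
      (fun p hp => (hM₁ p hp).trans ((le_max_left _ _).trans (le_max_left _ _)))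
      (fun p hp => (hM₂ p hp).trans ((le_max_right _ _).trans (le_max_left _ _)))
      (fun p hp => (mul_le_mul_of_nonneg_left (hM₃ p hp) zero_le_two).trans
        ((le_max_left _ _).trans (le_max_right _ _)))
      hτ hS ⟨by linarith [ht.1], by linarith [ht.2]⟩ hfin hn).trans ?_
    have e : θ₀ + r - (θ₀ - r) = 2 * r := by ring
    rw [e]
    have i1 : (2 * (ρ * (2 * r / Real.sqrt ε) + 1) * (M / c) +
        2 * r * (M / c + M * M / c ^ 2)) * (B * (C₁ * ℓ)) ≤ b₁ * (ℓ * (1 / Real.sqrt ε)) := by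
      have : 2 * (ρ * (2 * r / Real.sqrt ε) + 1) * (M / c) + 2 * r * (M / c + M * M / c ^ 2) ≤
          (2 * (2 * r * ρ + 1) * (M / c) + 2 * r * (M / c + M * M / c ^ 2)) *
            (1 / Real.sqrt ε) := by
        have j1 : 0 ≤ M / c := by positivity
        have j2 : 0 ≤ 2 * r * (M / c + M * M / c ^ 2) := by positivity
        have j3 : 2 * r / Real.sqrt ε = 2 * r * (1 / Real.sqrt ε) := by ring
        rw [j3]
        nlinarith [mul_nonneg j1 (sub_nonneg.2 hw), mul_nonneg j2 (sub_nonneg.2 hw)]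
      calc _ ≤ _ := mul_le_mul_of_nonneg_right this (by positivity)
        _ = _ := by simp only [b₁]; ring
    have i2 : (K.card : ℝ) * (M * (B / c ^ 2)) * (2 * r) ≤ b₂ * (ℓ * (1 / Real.sqrt ε)) := by
      have h1 := hcard ε hε0 he1 K R.angle
      calc (K.card : ℝ) * (M * (B / c ^ 2)) * (2 * r) ≤ C₂ * ℓ * (M * (B / c ^ 2)) * (2 * r) := by
            gcongr
        _ = b₂ * (ℓ * 1) := by simp only [b₂]; ring
        _ ≤ _ := by gcongr
    linarith
  have hcontF : Continuous fun z =>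
      (∑ k ∈ K, τ k * A' k (dot2 (vec ((k : ℝ) * (κ * ε))) z)) * ψ z :=
    (continuous_finsetSum _ fun k hk =>
      continuous_const.mul ((R.cont k hk).comp (continuous_dot2 _))).mul hψ.continuous
  have hassoc : ∀ z, (∑ k ∈ K, τ k * A' k (dot2 (vec ((k : ℝ) * (κ * ε))) z)) * (ψ z * f ε z) =
      (∑ k ∈ K, τ k * A' k (dot2 (vec ((k : ℝ) * (κ * ε))) z)) * ψ z * f ε z :=
    fun z => (mul_assoc _ _ _).symm
  simp only [hassoc]
  rw [D.integral_eq hy hdf.continuous hcontF (hHc ε hε) (hsupp _) (hf ε hε)]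
  have hcongr : ∀ t θ, σ * tubeDet y (t, θ) *
      ((∑ k ∈ K, τ k * A' k (dot2 (vec ((k : ℝ) * (κ * ε))) (tube y (t, θ)))) *
        ψ (tube y (t, θ)) * df (tube y (t, θ))) * jumpSign (H ε) (t, θ) =
      (∑ k ∈ K, τ k * (Γ (t, θ) * A' k (dot2 (vec ((k : ℝ) * (κ * ε))) (tube y (t, θ))))) *
        jumpSign (H ε) (t, θ) := by
    intro t θ
    congr 1
    rw [Finset.sum_mul, Finset.sum_mul, Finset.mul_sum]
    refine Finset.sum_congr rfl fun k _ => ?_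
    simp only [Γ]; ring
  simp only [hcongr]
  have hsubset : Set.Icc (-(c₀ * ε)) (c₀ * ε) ⊆ Set.Ioo (-r) r := fun t ht =>
    ⟨by linarith [ht.1], by linarith [ht.2]⟩
  rw [setIntegral_eq_of_subset_of_forall_sdiff_eq_zero measurableSet_Ioo hsubset fun t ht => by
    have hlarge : c₀ * ε < |t| := by
      by_contra! hcon
      exact ht.2 (abs_le.1 hcon)
    have hz : ∀ θ, jumpSign (H ε) (t, θ) = 0 := fun θ =>
      jumpSign_eq_zero ((hH ε hε θ).trans_lt hlarge)
    simp only [hz, mul_zero, intervalIntegral.integral_zero]]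
  refine (norm_setIntegral_le_of_norm_le_const measure_Icc_lt_top hslice).trans ?_
  rw [Real.volume_real_Icc_of_le (by nlinarith)]
  have e : (b₁ + b₂) * (ℓ * (1 / Real.sqrt ε)) * (c₀ * ε - -(c₀ * ε)) =
      (b₁ + b₂) * (2 * c₀) * (Real.log (1 / ε) / Real.sqrt ε) := by
    simp only [ℓ]; field_simp; ring
  rw [e]
  gcongr
  linarith

/-- A finite smooth partition of unity on a neighbourhood of a compact set. -/
lemma exists_finite_partition {K₀ : Set (ℝ × ℝ)} (hK : IsCompact K₀) {P : Set (ℝ × ℝ) → Prop}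
    (h : ∀ z ∈ K₀, ∃ U, IsOpen U ∧ z ∈ U ∧ P U) :
    ∃ (n : ℕ) (ψ : Fin n → ℝ × ℝ → ℝ) (U : Fin n → Set (ℝ × ℝ)) (r : ℝ), 0 < r ∧
      (∀ i, P (U i)) ∧ (∀ i, ContDiff ℝ 1 (ψ i)) ∧ (∀ i, Function.support (ψ i) ⊆ U i) ∧
      ∀ z ∈ Metric.cthickening r K₀, ∑ i, ψ i z = 1 := by
  choose! U hUo hUm hUP using h
  obtain ⟨t, ht⟩ := hK.elim_nhds_subcover' (fun z _ => U z)
    (fun z hz => (hUo z hz).mem_nhds (hUm z hz))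
  set e := t.equivFin.symm
  have hcov' : K₀ ⊆ ⋃ i, U (e i : K₀) := fun z hz => by
    obtain ⟨s, hs, hz⟩ := Set.mem_iUnion₂.1 (ht hz)
    exact Set.mem_iUnion.2 ⟨e.symm ⟨s, hs⟩, by simpa using hz⟩
  have hUo' : ∀ i, IsOpen (U (e i : K₀)) := fun i => hUo _ (e i : K₀).2
  obtain ⟨r, hr, hrU⟩ := hK.exists_cthickening_subset_open (isOpen_iUnion hUo') hcov'
  obtain ⟨φ, hφ⟩ := SmoothPartitionOfUnity.exists_isSubordinate (modelWithCornersSelf ℝ (ℝ × ℝ))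
    Metric.isClosed_cthickening _ hUo' hrU
  refine ⟨_, fun i => φ i, _, r, hr, fun i => hUP _ (e i : K₀).2,
    fun i => (φ i).contMDiff.contDiff.of_le (by simp), fun i => (subset_tsupport _).trans (hφ i),
    fun z hz => ?_⟩
  rw [← finsum_eq_sum_of_fintype]
  exact φ.sum_eq_one hz

lemma controlled_of_partition {κ Q ε₀ c₀ r : ℝ} {x₀ : ℝ × ℝ} {f : ℝ → ℝ × ℝ → ℝ}
    {K₀ : Set (ℝ × ℝ)} {n : ℕ} {ψ : Fin n → ℝ × ℝ → ℝ} {U : Fin n → Set (ℝ × ℝ)}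
    (hr : 0 < r) (hc₀ : 0 < c₀)
    (hU : ∀ i, LocallyControlled κ Q ε₀ x₀ f (U i)) (hψ : ∀ i, ContDiff ℝ 1 (ψ i))
    (hs : ∀ i, Function.support (ψ i) ⊆ U i)
    (hsum : ∀ z ∈ Metric.cthickening r K₀, ∑ i, ψ i z = 1)
    (hf : ∀ ε ∈ Set.Ioo (0 : ℝ) ε₀, ∀ z, f ε z ≠ 0 → z ∈ Metric.cthickening (c₀ * ε) K₀) :
    (∀ ε ∈ Set.Ioo 0 ε₀, ε < r / c₀ → ∀ F : ℝ × ℝ → ℝ, Continuous F →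
      Integrable fun z => F z * f ε z) ∧
    ∀ B : ℝ, 0 < B → ∃ C δ ε₁ : ℝ, 0 < C ∧ 0 < δ ∧ 0 < ε₁ ∧ ε₁ ≤ r / c₀ ∧
      ∀ ε ∈ Set.Ioo 0 ε₀, ε < ε₁ →
      ∀ x, dist x x₀ < δ → ∀ (K : Finset ℤ) (A A' : ℤ → ℝ → ℝ),
      ResponseFamily κ ε B Q x K A A' → ∀ τ : ℤ → ℝ, (∀ k, |τ k| ≤ 1) →
      |∫ z, (∑ k ∈ K, τ k * A' k (dot2 (vec ((k : ℝ) * (κ * ε))) z)) * f ε z| ≤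
        C * (Real.log (1 / ε) / Real.sqrt ε) := by
  have key : ∀ ε ∈ Set.Ioo 0 ε₀, ε < r / c₀ → ∀ z, f ε z = ∑ i, ψ i z * f ε z := by
    intro ε hε hlt z
    rw [lt_div_iff₀ hc₀] at hlt
    rw [← Finset.sum_mul]
    by_cases h0 : f ε z = 0
    · rw [h0, mul_zero]
    · rw [hsum z (Metric.cthickening_mono (by linarith) _ (hf ε hε z h0)), one_mul]
  have key' : ∀ ε ∈ Set.Ioo 0 ε₀, ε < r / c₀ → ∀ F : ℝ × ℝ → ℝ, (fun z => F z * f ε z) =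
      fun z => ∑ i, F z * (ψ i z * f ε z) := fun ε hε hlt F => funext fun z => by
    rw [← Finset.mul_sum, ← key ε hε hlt]
  refine ⟨fun ε hε hlt F hF => ?_, fun B hB => ?_⟩
  · rw [key' ε hε hlt]
    exact integrable_finsetSum _ fun i _ => (hU i (ψ i) (hψ i) (hs i)).1 ε hε F hF
  choose C δ ε₁ hC hδ hε₁ hbd using fun i => (hU i (ψ i) (hψ i) (hs i)).2 B hB
  have hmin : ∀ g : Fin n → ℝ, (∀ i, 0 < g i) → ∀ b : ℝ, 0 < b →
      ∃ m, 0 < m ∧ m ≤ b ∧ ∀ i, m ≤ g i := by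
    intro g hg b hb
    have : ∀ᶠ m : ℝ in 𝓝[>] 0, 0 < m ∧ m ≤ b ∧ ∀ i, m ≤ g i := by
      exact eventually_mem_nhdsWithin.and ((eventually_nhdsWithin_of_eventually_nhds
        (eventually_le_nhds hb)).and (eventually_all.2 fun i =>
          eventually_nhdsWithin_of_eventually_nhds (eventually_le_nhds (hg i))))
    exact this.exists
  obtain ⟨δ', hδ', -, hδle⟩ := hmin δ hδ 1 one_pos
  obtain ⟨ε', hε', hε'm, hεle⟩ := hmin ε₁ hε₁ (min (r / c₀) 1) (by positivity)
  have hε'r := hε'm.trans (min_le_left _ _)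
  refine ⟨∑ i, C i + 1, δ', ε', add_pos_of_nonneg_of_pos
    (Finset.sum_nonneg fun i _ => (hC i).le) one_pos, hδ', hε', hε'r,
    fun ε hε hlt x hx K A A' R τ hτ => ?_⟩
  have hcont : Continuous fun z =>
      ∑ k ∈ K, τ k * A' k (dot2 (vec ((k : ℝ) * (κ * ε))) z) :=
    continuous_finsetSum _ fun k hk =>
      continuous_const.mul ((R.cont k hk).comp (continuous_dot2 _))
  rw [key' ε hε (hlt.trans_le hε'r), integral_finsetSum _ fun i _ =>
    (hU i (ψ i) (hψ i) (hs i)).1 ε hε _ hcont]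
  refine (Finset.abs_sum_le_sum_abs _ _).trans ((Finset.sum_le_sum fun i _ =>
    hbd i ε hε (hlt.trans_le (hεle i)) x (hx.trans_le (hδle i)) K A A' R τ hτ).trans ?_)
  rw [← Finset.sum_mul, add_mul]
  have hlog : 0 ≤ Real.log (1 / ε) := Real.log_nonneg (by
    rw [le_div_iff₀ hε.1]
    linarith [hε'm.trans (min_le_right _ _)])
  have : 0 ≤ Real.log (1 / ε) / Real.sqrt ε := by positivity
  linarith

lemma locallyControlled_of_eq_zero {κ Q ε₀ : ℝ} {x₀ : ℝ × ℝ} {f : ℝ → ℝ × ℝ → ℝ}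
    {U : Set (ℝ × ℝ)} (hU : ∀ ε ∈ Set.Ioo (0 : ℝ) ε₀, ∀ z ∈ U, f ε z = 0) :
    LocallyControlled κ Q ε₀ x₀ f U := by
  intro ψ _ hs
  have h0 : ∀ ε ∈ Set.Ioo (0 : ℝ) ε₀, ∀ z, ψ z * f ε z = 0 := fun ε hε z => by
    by_cases hz : ψ z = 0
    · rw [hz, zero_mul]
    · rw [hU ε hε z (hs hz), mul_zero]
  refine ⟨fun ε hε F _ => by simp [h0 ε hε], fun B _ => ⟨1, 1, 1, one_pos, one_pos, one_pos,
    fun ε hε h1 _ _ _ _ _ _ _ _ => ?_⟩⟩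
  have : 0 ≤ Real.log (1 / ε) := Real.log_nonneg (by rw [le_div_iff₀ hε.1]; linarith)
  simp only [h0 ε hε, mul_zero, integral_zero, abs_zero]
  positivity

/-- The Hölder condition implies continuity. -/
lemma continuous_of_holder_increment {h : ℝ → ℝ} {s C γ : ℝ} (hs : 0 < s) (hγ : 0 < γ)
    (hh : ∀ u v : ℝ, 0 < v → |h (u + s * v) - h u| ≤ C * v ^ γ) : Continuous h := by
  have key : ∀ u v, |h u - h v| ≤ C * (|u - v| / s) ^ γ := by
    have lt : ∀ u v, v < u → |h u - h v| ≤ C * (|u - v| / s) ^ γ := fun u v huv => by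
      have := hh v ((u - v) / s) (div_pos (by linarith) hs)
      rwa [mul_div_cancel₀ _ hs.ne', add_sub_cancel, ← abs_of_pos (sub_pos.2 huv)] at this
    intro u v
    rcases lt_trichotomy v u with h1 | rfl | h1
    · exact lt u v h1
    · simp [Real.zero_rpow hγ.ne']
    · rw [abs_sub_comm (h u), abs_sub_comm u]; exact lt v u h1
  refine continuous_iff_continuousAt.2 fun v => ?_
  rw [ContinuousAt, tendsto_iff_dist_tendsto_zero]
  refine squeeze_zero (fun _ => dist_nonneg) (fun u => key u v) ?_
  have hcont : Continuous fun u : ℝ => C * (|u - v| / s) ^ γ :=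
    continuous_const.mul ((Real.continuous_rpow_const hγ.le).comp (by fun_prop))
  have := hcont.tendsto v
  simpa [Real.zero_rpow hγ.ne'] using this

lemma tubeDet_zero_ne {y : ℝ → ℝ × ℝ} {θ : ℝ} (hreg : deriv y θ ≠ 0)
    (htan : dot2 (vec θ) (deriv y θ) = 0) : tubeDet y (0, θ) ≠ 0 := by
  intro h0
  simp only [tubeDet, zero_add] at h0
  simp only [dot2, vec] at htan
  have h1 := Real.cos_sq_add_sin_sq θ
  refine hreg (Prod.ext ?_ ?_)
  · simp only [Prod.fst_zero]
    linear_combination Real.cos θ * htan - Real.sin θ * h0 - (deriv y θ).1 * h1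
  · simp only [Prod.snd_zero]
    linear_combination Real.sin θ * htan + Real.cos θ * h0 - (deriv y θ).2 * h1

lemma KernelData.sum_abs_truncated_le {ψ w V : ℝ → ℝ} {R M B κ ε δ Q C b : ℝ} {x : ℝ × ℝ}
    {K : Finset ℤ} {N : ℤ} {f : ℝ × ℝ → ℝ} (D : KernelData ψ w V R M B) (hε : 0 < ε) (hδ : 0 < δ)
    (hδε : δ < ε) (hx : ‖x‖ ≤ Q) (hN : 3 * (2 * Q) / ε + R ≤ N)
    (hC₁ : 2 * (8 * (2 * (2 * R + 1) * (M * B)) * (2 * R) * (1 + 2 * R)) ≤ C)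
    (hC₂ : 16 * (2 * R + 1) * M * R ^ 2 * B ≤ C) (hC₃ : 4 * R ≤ C)
    (hK : ∀ k ∈ K, |(k : ℝ) * (κ * ε)| ≤ Real.pi / 2)
    (hInt : ∀ F : ℝ × ℝ → ℝ, Continuous F → Integrable fun z => F z * f z)
    (hb : ∀ A A' : ℤ → ℝ → ℝ, ResponseFamily κ ε C Q x K A A' → ∀ τ : ℤ → ℝ, (∀ k, |τ k| ≤ 1) →
      |∫ z, (∑ k ∈ K, τ k * A' k (dot2 (vec ((k : ℝ) * (κ * ε))) z)) * f z| ≤ b) :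
    ∑ k ∈ K, |∑ j ∈ Finset.Icc (-N) N, truncKernel ψ ε δ (dot2 (vec ((k : ℝ) * (κ * ε))) x) j *
      (ε⁻¹ * ∫ z, w (((j : ℝ) * ε - dot2 (vec ((k : ℝ) * (κ * ε))) z) / ε) * f z)| ≤ b := by
  have hR : 0 < R := by linarith [D.one_le]
  have hwc := D.aperture_cont
  set v : ℤ → ℝ × ℝ := fun k => vec ((k : ℝ) * (κ * ε))
  have hxk : ∀ k, |dot2 (v k) x| ≤ 2 * Q := fun k =>
    (abs_dot2_le _ _ (vec_unit _)).trans (by linarith)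
  choose A hA hA' using fun k => D.exists_response (N := N) hε hδ (hxk k) hN
  set A' : ℤ → ℝ → ℝ := fun k q => ∑ j ∈ Finset.Icc (-N) N,
    truncKernel ψ ε δ (dot2 (v k) x) j * (ε⁻¹ * w ((j * ε - q) / ε))
  have hcont : ∀ k, Continuous (A' k) := fun k => continuous_finsetSum _ fun j _ => by fun_prop
  have hres : ResponseFamily κ ε C Q x K A A' :=
    { angle := hK
      hasDerivAt := fun k _ => hA k
      cont := fun k _ => hcont k
      near := fun k _ q hq => (hA' k q hq).trans (by gcongr)
      far := fun k _ q hq => by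
        refine (D.abs_sum_truncKernel_mul_aperture_le _ hε hδε (le_trans ?_ hq)).trans ?_
        · gcongr
        · gcongr }
  set T : ℤ → ℝ := fun k => ∫ z, A' k (dot2 (v k) z) * f z
  have hT : ∀ k, ∑ j ∈ Finset.Icc (-N) N, truncKernel ψ ε δ (dot2 (v k) x) j *
      (ε⁻¹ * ∫ z, w (((j : ℝ) * ε - dot2 (v k) z) / ε) * f z) = T k := by
    intro k
    have hcd := continuous_dot2 (v k)
    simp only [T, A', Finset.sum_mul, mul_assoc]
    rw [integral_finsetSum _ fun (j : ℤ) _ => ((hInt _ (by fun_prop : Continuous fun z =>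
      w (((j : ℝ) * ε - dot2 (v k) z) / ε))).const_mul ε⁻¹).const_mul _]
    simp only [integral_const_mul]
  have hTi : ∀ k, Integrable fun z => A' k (dot2 (v k) z) * f z := fun k =>
    hInt _ ((hcont k).comp (continuous_dot2 _))
  rw [Finset.sum_congr rfl fun k _ => congrArg abs (hT k)]
  have := hb A A' hres (fun k => SignType.sign (T k)) fun k => by
    rcases lt_trichotomy (T k) 0 with h | h | h <;> simp [h]
  simp only [Finset.sum_mul, mul_assoc] at this
  rw [integral_finsetSum _ fun k _ => (hTi k).const_mul _] at this
  simp only [integral_const_mul] at this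
  refine le_trans (le_of_eq ?_) ((le_abs_self _).trans this)
  exact Finset.sum_congr rfl fun k _ => (sign_mul_self (T k)).symm

lemma finite_setOf_abs_intCast_mul_le {c : ℝ} (hc : 0 < c) (b : ℝ) :
    {k : ℤ | |(k : ℝ) * c| ≤ b}.Finite := by
  refine (Set.finite_Icc (-⌈b / c⌉) ⌈b / c⌉).subset fun k hk => ?_
  have hk' : |(k : ℝ)| * c ≤ b := by
    have hk' : |(k : ℝ) * c| ≤ b := hk
    rwa [abs_mul, abs_of_pos hc] at hk'
  rw [← le_div_iff₀ hc, abs_le] at hk'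
  have := Int.le_ceil (b / c)
  constructor
  · have : (-⌈b / c⌉ : ℝ) ≤ k := by linarith
    exact_mod_cast this
  · have : (k : ℝ) ≤ ⌈b / c⌉ := by linarith
    exact_mod_cast this

lemma KernelData.sum_abs_principalValue_le {ik w V : ℝ → ℝ} {R M B κ ε Q C b : ℝ} {x : ℝ × ℝ}
    {K : Finset ℤ} {f : ℝ × ℝ → ℝ} {fhat : ℤ → ℤ → ℝ} {P : ℤ → ℝ}
    (D : KernelData (deriv ik) w V R M B) (hik : ∀ s, DifferentiableAt ℝ ik s)
    (hε : 0 < ε) (hx : ‖x‖ ≤ Q) (hf : ∀ z, f z ≠ 0 → ‖z‖ ≤ Q)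
    (hC₁ : 2 * (8 * (2 * (2 * R + 1) * (M * B)) * (2 * R) * (1 + 2 * R)) ≤ C)
    (hC₂ : 16 * (2 * R + 1) * M * R ^ 2 * B ≤ C) (hC₃ : 4 * R ≤ C)
    (hK : ∀ k ∈ K, |(k : ℝ) * (κ * ε)| ≤ Real.pi / 2)
    (hInt : ∀ F : ℝ × ℝ → ℝ, Continuous F → Integrable fun z => F z * f z)
    (hb : ∀ A A' : ℤ → ℝ → ℝ, ResponseFamily κ ε C Q x K A A' → ∀ τ : ℤ → ℝ, (∀ k, |τ k| ≤ 1) →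
      |∫ z, (∑ k ∈ K, τ k * A' k (dot2 (vec ((k : ℝ) * (κ * ε))) z)) * f z| ≤ b)
    (hfhat : ∀ k j : ℤ, fhat k j = ε⁻¹ * ∫ z : ℝ × ℝ,
      w (((j : ℝ) * ε - dot2 (vec ((k : ℝ) * (κ * ε))) z) / ε) * f z)
    (hP : ∀ k : ℤ, Tendsto (fun δ : ℝ =>
      ∫ p in {p : ℝ | δ < |p - dot2 (vec ((k : ℝ) * (κ * ε))) x|},
        deriv (fun p' : ℝ => ∑' j : ℤ, ik ((p' - (j : ℝ) * ε) / ε) * fhat k j) p /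
          (p - dot2 (vec ((k : ℝ) * (κ * ε))) x)) (𝓝[>] (0:ℝ)) (𝓝 (P k))) :
    ∑ k ∈ K, |P k| ≤ b := by
  have hR : 0 < R := by linarith [D.one_le]
  have hQ : 0 ≤ Q := (norm_nonneg x).trans hx
  set N := ⌈3 * (2 * Q) / ε + R⌉
  have hN : 3 * (2 * Q) / ε + R ≤ N := Int.le_ceil _
  have hzero : ∀ k, ∀ j ∉ Finset.Icc (-N) N, fhat k j = 0 := by
    intro k j hj
    have hj' : (N : ℝ) < |(j : ℝ)| := by
      by_contra! hcon
      rw [abs_le] at hcon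
      exact hj (Finset.mem_Icc.2 ⟨by exact_mod_cast hcon.1, by exact_mod_cast hcon.2⟩)
    rw [hfhat, integral_eq_zero_of_ae (ae_of_all _ fun z => ?_), mul_zero]
    by_cases hz : f z = 0
    · simp [hz]
    have h1 : |dot2 (vec ((k : ℝ) * (κ * ε))) z| ≤ 2 * Q :=
      (abs_dot2_le _ _ (vec_unit _)).trans (by linarith [hf z hz])
    have h2 : 3 * (2 * Q) + R * ε < |(j : ℝ) * ε| := by
      rw [abs_mul, abs_of_pos hε]
      have := mul_lt_mul_of_pos_right (hN.trans_lt hj') hε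
      rwa [add_mul, div_mul_cancel₀ _ hε.ne'] at this
    have h3 : R < |((j : ℝ) * ε - dot2 (vec ((k : ℝ) * (κ * ε))) z) / ε| := by
      rw [abs_div, abs_of_pos hε, lt_div_iff₀ hε]
      linarith [abs_sub_abs_le_abs_sub ((j : ℝ) * ε) (dot2 (vec ((k : ℝ) * (κ * ε))) z)]
    simp [D.aperture_support _ h3]
  refine le_of_tendsto (tendsto_finsetSum K fun k _ => (hP k).abs) ?_
  filter_upwards [Ioo_mem_nhdsGT hε] with δ hδ
  simp only [truncated_integral_eq_sum hε hδ.1 _ hik D.kernel_cont D.kernel_support (hzero _)]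
  simp only [hfhat]
  exact D.sum_abs_truncated_le hε hδ.1 hδ.2 hx hN hC₁ hC₂ hC₃ hK hInt hb

lemma exists_dist_le_of_ne_zero {y : ℝ → ℝ × ℝ} {a b : ℝ} {h : ℝ → ℝ} {f df : ℝ × ℝ → ℝ}
    (hh : ∀ s, |h s| ≤ b)
    (hf : ∀ θ ∈ Set.Icc (-a) a, ∀ t,
      f (tube y (t, θ)) = jumpSign h (t, θ) * df (tube y (t, θ)))
    (hout : ∀ x, (∀ θ ∈ Set.Icc (-a) a, ∀ t : ℝ, x ≠ y θ + t • vec θ) → f x = 0)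
    {z : ℝ × ℝ} (hz : f z ≠ 0) : ∃ θ ∈ Set.Icc (-a) a, dist z (y θ) ≤ b := by
  by_contra! hfar
  refine hz (hout z ?_)
  rintro θ hθ t rfl
  have hlt := hfar θ hθ
  rw [dist_eq_norm, add_sub_cancel_left, norm_smul, Real.norm_eq_abs] at hlt
  have hv : ‖vec θ‖ ≤ 1 := max_le (Real.abs_cos_le_one θ) (Real.abs_sin_le_one θ)
  have hle : |h θ| < |t| :=
    ((hh θ).trans_lt hlt).trans_le (mul_le_of_le_one_right (abs_nonneg t) hv)
  refine hz ((hf θ hθ t).trans ?_)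
  rw [jumpSign_eq_zero hle, zero_mul]

/-- Lemma `partial res`: assume `ĩk(λ) = O(|λ|⁻³)`, let
`x₀ ∉ S` be such that no line through `x₀` intersecting `S` is tangent to `S`,
and suppose the level sets of `H₀ = ε⁻¹H_ε(ε^{1/2}·)` are well-behaved.  Then
`f_ε^rec(x) = O(ε^{1/2} ln(1/ε))` as `ε → 0`, uniformly for `x` in a
sufficiently small neighborhood of `x₀`. -/
theorem stmt_9 (x₀ : ℝ × ℝ)
    (w ik : ℝ → ℝ) (κ γ a c₀ ε₀ : ℝ)
    (hκ : 0 < κ) (hγ : γ ∈ Set.Ioc (0:ℝ) 1) (ha : 0 < a)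
    (hc₀ : 0 < c₀) (hε₀ : 0 < ε₀)
    -- the detector aperture function w ∈ C₀²(ℝ), even, with ∫ w = 1
    (hw_even : ∀ p : ℝ, w (-p) = w p)
    (hw_supp : HasCompactSupport w)
    (hw_d1 : ∀ p : ℝ, DifferentiableAt ℝ w p)
    (hw_d2 : ∀ p : ℝ, DifferentiableAt ℝ (deriv w) p)
    (hw_bdd : ∃ M : ℝ, ∀ᵐ p : ℝ, |deriv (deriv w) p| ≤ M)
    (hw_int : ∫ p : ℝ, w p = 1)
    -- the interpolation kernel ik ∈ C₀²(ℝ), even, exact up to order 1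
    (hik_even : ∀ p : ℝ, ik (-p) = ik p)
    (hik_supp : HasCompactSupport ik)
    (hik_d1 : ∀ p : ℝ, DifferentiableAt ℝ ik p)
    (hik_d2 : ∀ p : ℝ, DifferentiableAt ℝ (deriv ik) p)
    (hik_bdd : ∃ M : ℝ, ∀ᵐ p : ℝ, |deriv (deriv ik) p| ≤ M)
    (hik_exact0 : ∀ u : ℝ, ∑' j : ℤ, ik (u - (j : ℝ)) = 1)
    (hik_exact1 : ∀ u : ℝ, ∑' j : ℤ, (j : ℝ) * ik (u - (j : ℝ)) = u)
    -- additionally, the Fourier transform ĩk(λ) = O(|λ|⁻³)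
    (hik_decay : ∃ Cd : ℝ, ∀ l : ℝ, 1 ≤ |l| →
      ‖∫ x : ℝ, (ik x : ℂ) * Complex.exp (Complex.I * l * x)‖ ≤ Cd / |l| ^ 3)
    -- the perturbation family: H1 and H2
    (H : ℝ → ℝ → ℝ)
    (hH1 : ∀ ε ∈ Set.Ioo (0:ℝ) ε₀, ∀ s : ℝ, |H ε s| ≤ c₀ * ε)
    (hH2 : ∀ ε ∈ Set.Ioo (0:ℝ) ε₀, ∀ s h : ℝ, 0 < h →
      |H ε (s + Real.sqrt ε * h) - H ε s| ≤ c₀ * ε * h ^ γ)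
    -- the C⁴ curve S with positive curvature, parametrized by tangency:
    -- the line with normal Θ⃗(θ) through y_*(θ) is tangent to S at y_*(θ),
    -- and the radius of curvature R(θ) = Θ⃗ · y_*''(θ) is positive
    (y : ℝ → ℝ × ℝ)
    (hy_smooth : ContDiff ℝ 4 y)
    (hy_reg : ∀ θ ∈ Set.Icc (-a) a, deriv y θ ≠ 0)
    (hy_tangent : ∀ θ ∈ Set.Icc (-a) a, dot2 (vec θ) (deriv y θ) = 0)
    (hy_curv : ∀ θ ∈ Set.Icc (-a) a, 0 < dot2 (vec θ) (deriv (deriv y) θ))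
    -- the jump Δf ∈ C²(ℝ²), vanishing near the endpoints of the curve
    (df : ℝ × ℝ → ℝ)
    (hdf : ContDiff ℝ 2 df)
    (hdf_vanish : ∃ δ : ℝ, 0 < δ ∧ ∀ x : ℝ × ℝ,
      (dist x (y a) < δ ∨ dist x (y (-a)) < δ) → df x = 0)
    -- the perturbation function f_ε, supported in the tube between S and S_ε
    (fpert : ℝ → ℝ × ℝ → ℝ)
    (hfpert_tube : ∀ ε ∈ Set.Ioo (0:ℝ) ε₀, ∀ θ ∈ Set.Icc (-a) a, ∀ t : ℝ,
      fpert ε (y θ + t • vec θ) =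
        if 0 < t ∧ t < H ε θ then df (y θ + t • vec θ)
        else if H ε θ < t ∧ t < 0 then -df (y θ + t • vec θ) else 0)
    (hfpert_out : ∀ ε ∈ Set.Ioo (0:ℝ) ε₀, ∀ x : ℝ × ℝ,
      (∀ θ ∈ Set.Icc (-a) a, ∀ t : ℝ, x ≠ y θ + t • vec θ) → fpert ε x = 0)
    -- the discrete data f̂_ε(α_k, p_j), α_k = kκε, p_j = jε
    (fhat : ℝ → ℤ → ℤ → ℝ)
    (hfhat : ∀ ε : ℝ, ∀ k j : ℤ, fhat ε k j =
      ε⁻¹ * ∫ z : ℝ × ℝ,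
        w (((j : ℝ) * ε - dot2 (vec ((k : ℝ) * (κ * ε))) z) / ε) * fpert ε z)
    -- the principal value integrals appearing in the inversion formula
    (Ipv : ℝ → ℤ → ℝ × ℝ → ℝ)
    (hIpv : ∀ ε ∈ Set.Ioo (0:ℝ) ε₀, ∀ (k : ℤ) (x : ℝ × ℝ),
      Tendsto (fun δ : ℝ =>
          ∫ p in {p : ℝ | δ < |p - dot2 (vec ((k : ℝ) * (κ * ε))) x|},
            deriv (fun p' : ℝ =>
              ∑' j : ℤ, ik ((p' - (j : ℝ) * ε) / ε) * fhat ε k j) p /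
              (p - dot2 (vec ((k : ℝ) * (κ * ε))) x))
        (𝓝[>] (0:ℝ)) (𝓝 (Ipv ε k x)))
    -- the reconstruction from discrete data
    (frec : ℝ → ℝ × ℝ → ℝ)
    (hfrec : ∀ ε : ℝ, ∀ x : ℝ × ℝ, frec ε x =
      -(κ * ε / (2 * Real.pi)) * ∑' k : ℤ,
        (if |(k : ℝ) * (κ * ε)| ≤ Real.pi / 2
          then (1 / Real.pi) * Ipv ε k x else 0))
    -- x₀ does not lie on S, and no line through x₀ intersecting S is
    -- tangent to S: the tangent line of S at any point never passes through x₀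
    (hx₀ : x₀ ∉ y '' Set.Icc (-a) a)
    (hnotan : ∀ θ ∈ Set.Icc (-a) a,
      (x₀ - y θ).1 * (deriv y θ).2 ≠ (x₀ - y θ).2 * (deriv y θ).1)
    -- the level sets of H₀ = ε⁻¹H_ε(ε^{1/2}·) are well-behaved: any open
    -- interval of length L ≥ L₀ contains at most ρL points of H₀⁻¹(th)
    (hlevel : ∃ ρ L₀ : ℝ, 0 < ρ ∧ 0 < L₀ ∧ ∀ ε ∈ Set.Ioo (0:ℝ) ε₀,
      ∀ th b L : ℝ, L₀ ≤ L →
        {s : ℝ | s ∈ Set.Ioo b (b + L) ∧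
          ε⁻¹ * H ε (Real.sqrt ε * s) = th}.Finite ∧
        (({s : ℝ | s ∈ Set.Ioo b (b + L) ∧
          ε⁻¹ * H ε (Real.sqrt ε * s) = th}.ncard : ℝ)) ≤ ρ * L) :
    ∃ C δ ε₁ : ℝ, 0 < C ∧ 0 < δ ∧ 0 < ε₁ ∧ ε₁ ≤ ε₀ ∧ ε₁ < 1 ∧
      ∀ ε ∈ Set.Ioo (0:ℝ) ε₁, ∀ x : ℝ × ℝ, dist x x₀ < δ →
        |frec ε x| ≤ C * Real.sqrt ε * Real.log (1 / ε) := by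
  have hγ0 := hγ.1
  obtain ⟨ρ, L₀, hρ, hL₀, hlev⟩ := hlevel
  obtain ⟨V, R, M, B, D⟩ := KernelData.of_kernels hw_supp hw_d1 hw_int hik_supp hik_d1 hik_d2
    hik_bdd hik_exact0
  have hR : 0 < R := by linarith [D.one_le]
  have hM := D.M_nonneg
  have hB := D.B_nonneg
  have hycont : Continuous y := hy_smooth.continuous
  have hcpt : IsCompact (y '' Set.Icc (-a) a) := isCompact_Icc.image hycont
  obtain ⟨Q₀, hQ₀⟩ := hcpt.isBounded.exists_norm_le
  set Q := max Q₀ ‖x₀‖ + 1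
  have hQy : ∀ θ ∈ Set.Icc (-a) a, ‖y θ‖ + 1 ≤ Q := fun θ hθ => by
    linarith [hQ₀ _ (Set.mem_image_of_mem y hθ), le_max_left Q₀ ‖x₀‖]
  have hQx : ‖x₀‖ + 1 ≤ Q := by linarith [le_max_right Q₀ ‖x₀‖]
  have htube : ∀ ε ∈ Set.Ioo (0 : ℝ) ε₀, ∀ θ ∈ Set.Icc (-a) a, ∀ t,
      fpert ε (tube y (t, θ)) = jumpSign (H ε) (t, θ) * df (tube y (t, θ)) := by
    intro ε hε θ hθ t
    rw [tube, hfpert_tube ε hε θ hθ t, jumpSign]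
    split_ifs <;> simp
  have hHc : ∀ ε ∈ Set.Ioo (0 : ℝ) ε₀, Continuous (H ε) := fun ε hε =>
    continuous_of_holder_increment (Real.sqrt_pos.2 hε.1) hγ0 (hH2 ε hε)
  have hnear : ∀ ε ∈ Set.Ioo (0 : ℝ) ε₀, ∀ z, fpert ε z ≠ 0 →
      ∃ θ ∈ Set.Icc (-a) a, dist z (y θ) ≤ c₀ * ε := fun ε hε z hz =>
    exists_dist_le_of_ne_zero (hH1 ε hε) (htube ε hε) (hfpert_out ε hε) hz
  obtain ⟨n, ψ, U, r, hr, hU, hψ, hψU, hsum⟩ := exists_finite_partition hcpt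
    (P := LocallyControlled κ Q ε₀ x₀ fpert) (Set.forall_mem_image.2 fun θ hθ => by
      by_cases hend : θ = a ∨ θ = -a
      · obtain ⟨δ, hδ, hvan⟩ := hdf_vanish
        refine ⟨Metric.ball (y θ) δ, Metric.isOpen_ball, Metric.mem_ball_self hδ,
          locallyControlled_of_eq_zero fun ε hε z hz => ?_⟩
        have hz0 : df z = 0 := hvan z (by
          rcases hend with rfl | rfl
          · exact Or.inl hz
          · exact Or.inr hz)
        by_contra hne
        refine hne (hfpert_out ε hε z ?_)
        rintro s hs t rfl
        refine hne ((htube ε hε s hs t).trans ?_)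
        rw [tube, hz0, mul_zero]
      · push Not at hend
        obtain ⟨r, c, d, σ, T⟩ := exists_tubeBox hy_smooth (x₀ := x₀) (Q := Q)
          ⟨lt_of_le_of_ne hθ.1 hend.2.symm, lt_of_le_of_ne hθ.2 hend.1⟩
          (tubeDet_zero_ne (hy_reg θ hθ) (hy_tangent θ hθ)) (by linarith [hQy θ hθ]) (hnotan θ hθ)
        exact ⟨_, T.isOpen_image, ⟨(0, θ), Metric.mem_ball_self T.radius_pos, by simp [tube]⟩,
          T.locallyControlled hy_smooth hκ hc₀ (hdf.of_le one_le_two) hρ hL₀ hHc hH1 htube hlev⟩)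
  obtain ⟨hInt, hbd⟩ := controlled_of_partition hr hc₀ hU hψ hψU hsum fun ε hε z hz => by
    obtain ⟨θ, hθ, hd⟩ := hnear ε hε z hz
    exact Metric.mem_cthickening_of_dist_le _ _ _ _ (Set.mem_image_of_mem y hθ) hd
  set B' := max (2 * (8 * (2 * (2 * R + 1) * (M * B)) * (2 * R) * (1 + 2 * R)))
    (max (16 * (2 * R + 1) * M * R ^ 2 * B) (4 * R))
  have hB' : 0 < B' := lt_of_lt_of_le (by positivity)
    ((le_max_right _ (4 * R)).trans (le_max_right _ _))
  obtain ⟨C, δ, ε₁, hC, hδ, hε₁, hε₁r, hmain⟩ := hbd B' hB'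
  refine ⟨κ / (2 * Real.pi) * (1 / Real.pi) * C, min δ 1,
    min (min ε₁ ε₀) (min (1 / c₀) (1 / 2)), by positivity, by positivity, by positivity,
    (min_le_left _ _).trans (min_le_right _ _),
    ((min_le_right _ _).trans (min_le_right _ _)).trans_lt (by norm_num), fun ε hε x hx => ?_⟩
  have hε0 := hε.1
  have he1 : ε < ε₁ := hε.2.trans_le ((min_le_left _ _).trans (min_le_left _ _))
  have he2 : ε ∈ Set.Ioo (0 : ℝ) ε₀ :=
    ⟨hε0, hε.2.trans_le ((min_le_left _ _).trans (min_le_right _ _))⟩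
  have he3 : ε < 1 / c₀ := hε.2.trans_le ((min_le_right _ _).trans (min_le_left _ _))
  rw [lt_div_iff₀ hc₀] at he3
  have hxQ : ‖x‖ ≤ Q := by
    have h1 := (norm_le_norm_add_norm_sub' x x₀)
    rw [← dist_eq_norm] at h1
    linarith [hx.trans_le (min_le_right _ _)]
  have hfin := finite_setOf_abs_intCast_mul_le (mul_pos hκ hε0) (Real.pi / 2)
  set K := hfin.toFinset
  have hK : ∀ k, k ∈ K ↔ |(k : ℝ) * (κ * ε)| ≤ Real.pi / 2 := fun k => by
    simp only [K, Set.Finite.mem_toFinset, Set.mem_ofPred_eq]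
  have hsumP := D.sum_abs_principalValue_le (Q := Q) (C := B') hik_d1 hε0 hxQ (fun z hz => by
      obtain ⟨θ, hθ, hd⟩ := hnear ε he2 z hz
      have h1 := (norm_le_norm_add_norm_sub' z (y θ))
      rw [← dist_eq_norm] at h1
      linarith [hQy θ hθ])
    (le_max_left _ _) ((le_max_left _ _).trans (le_max_right _ _))
    ((le_max_right _ _).trans (le_max_right _ _)) (fun k hk => (hK k).1 hk)
    (hInt ε he2 (he1.trans_le hε₁r)) (fun A A' RF τ hτ =>
      hmain ε he2 he1 x (hx.trans_le (min_le_left _ _)) K A A' RF τ hτ)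
    (hfhat ε) (fun k => hIpv ε he2 k x)
  rw [hfrec, tsum_eq_sum (s := K) fun k hk => if_neg fun h => hk ((hK k).2 h),
    Finset.sum_congr rfl fun k hk => if_pos ((hK k).1 hk), ← Finset.mul_sum, abs_mul, abs_mul,
    abs_neg, abs_of_pos (by positivity : 0 < κ * ε / (2 * Real.pi)),
    abs_of_pos (by positivity : 0 < 1 / Real.pi)]
  have hs := Real.sqrt_pos.2 hε0
  calc κ * ε / (2 * Real.pi) * (1 / Real.pi * |∑ k ∈ K, Ipv ε k x|)
      ≤ κ * ε / (2 * Real.pi) * (1 / Real.pi * (C * (Real.log (1 / ε) / Real.sqrt ε))) := by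
        gcongr
        exact (Finset.abs_sum_le_sum_abs _ _).trans hsumP
    _ = κ / (2 * Real.pi) * (1 / Real.pi) * C * (ε / Real.sqrt ε) * Real.log (1 / ε) := by ring
    _ = κ / (2 * Real.pi) * (1 / Real.pi) * C * Real.sqrt ε * Real.log (1 / ε) := by
        rw [Real.div_sqrt]
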